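/- Main Lemma: Fix k ≥ 2. Let P be a rook placement on a Ferrers board F containing the pattern k…1, let D = D₁…D_k be the lexicographically value-smallest occurrence of k…1 in P, and let R = R(a,b) where a = col(D_k) and b = row(D₁). Then seq(P_R, R) = seq(φ(P)_R, R) except possibly at the northeast corner of R (the NE corner of square (a,b)); here P_R and φ(P)_R are the restrictions of P and φ(P) to R. -/

import Mathlib

open scoped Classical

/-- A cell (square) of the grid: `(column, row)`, both `≥ 1` for genuine cells. -/
abbrev Cell : Type := ℕ × ℕ

/-- The rectangle `R(a,b)` consisting of all cells `(i,j)` with `1 ≤ i ≤ a`, `1 ≤ j ≤ b`. -/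
def Rect (a b : ℕ) : Finset Cell := Finset.Icc 1 a ×ˢ Finset.Icc 1 b

/-- A Ferrers board (French notation): a down-left closed finite set of cells with
positive coordinates. -/
def IsFerrers (F : Finset Cell) : Prop :=
  ∀ p ∈ F, 1 ≤ p.1 ∧ 1 ≤ p.2 ∧
    ∀ q : Cell, 1 ≤ q.1 → 1 ≤ q.2 → q.1 ≤ p.1 → q.2 ≤ p.2 → q ∈ F

/-- A rook placement on a board `F`: a subset of `F` with at most one cell in each
column and at most one cell in each row. -/
def IsPlacement (F P : Finset Cell) : Prop :=
  P ⊆ F ∧ (∀ p ∈ P, ∀ q ∈ P, p.1 = q.1 → p = q) ∧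
    (∀ p ∈ P, ∀ q ∈ P, p.2 = q.2 → p = q)

/-- A decreasing sequence in `P`: columns strictly increase, rows strictly decrease. -/
def IsDecSeq (P : Finset Cell) (k : ℕ) (S : Fin k → Cell) : Prop :=
  (∀ i, S i ∈ P) ∧ ∀ i j : Fin k, i < j → (S i).1 < (S j).1 ∧ (S j).2 < (S i).2

/-- An increasing sequence in `P`: columns and rows both strictly increase. -/
def IsIncSeq (P : Finset Cell) (k : ℕ) (S : Fin k → Cell) : Prop :=
  (∀ i, S i ∈ P) ∧ ∀ i j : Fin k, i < j → (S i).1 < (S j).1 ∧ (S i).2 < (S j).2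

/-- Lexicographic comparison of two sequences of cells by their rows (values),
entry by entry from the left. -/
def rowLexLE (k : ℕ) (S T : Fin k → Cell) : Prop :=
  (∀ i, (S i).2 = (T i).2) ∨
    ∃ i : Fin k, (S i).2 < (T i).2 ∧ ∀ j : Fin k, j < i → (S j).2 = (T j).2

/-- An occurrence of the decreasing pattern `k…1` in the placement `P` on the board `F`:
a decreasing sequence of cells of `P`, all lying in a common rectangle contained in `F`. -/
def IsDecOcc (F P : Finset Cell) (k : ℕ) (D : Fin k → Cell) : Prop :=
  IsDecSeq P k D ∧ ∃ a b : ℕ, Rect a b ⊆ F ∧ ∀ i, D i ∈ Rect a b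

/-- `D` is the lexicographically value-smallest occurrence of `k…1` in `P`. -/
def IsMinOcc (F P : Finset Cell) (k : ℕ) (D : Fin k → Cell) : Prop :=
  IsDecOcc F P k D ∧ ∀ S : Fin k → Cell, IsDecOcc F P k S → rowLexLE k D S

/-- Cyclic successor on `Fin k`. -/
def cyc (k : ℕ) (i : Fin k) : Fin k :=
  ⟨(i.1 + 1) % k, Nat.mod_lt _ (Nat.lt_of_le_of_lt (Nat.zero_le _) i.isLt)⟩

/-- The action of `φ` on `P`, given the occurrence `D = D₁…D_k` of `k…1`: the columns of
`D₁,…,D_k` receive markers at the rows of `D₂,…,D_k,D₁` respectively; other cells are fixed. -/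
def phiStep (k : ℕ) (D : Fin k → Cell) (P : Finset Cell) : Finset Cell :=
  (P \ Finset.image D Finset.univ) ∪
    Finset.image (fun i : Fin k => ((D i).1, (D (cyc k i)).2)) Finset.univ

/-- The (least) index at which two partitions (written as functions `ℕ → ℕ`,
`0`-indexed entries) differ. -/
noncomputable def diffIdx (f g : ℕ → ℕ) : ℕ := sInf {n | f n ≠ g n}

/-- Fomin's local growth rule, computing the `NE` partition from `NW`, `SW`, `SE` and
whether the square holds a marker. Partitions are functions `ℕ → ℕ` (entry `n+1` is `f n`). -/
noncomputable def gdaRule (NW SW SE : ℕ → ℕ) (marked : Bool) : ℕ → ℕ :=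
  if NW ≠ SE then fun n => max (NW n) (SE n)
  else if SW ≠ NW then fun n => NW n + if n = diffIdx SW NW + 1 then 1 else 0
  else if marked then fun n => SW n + if n = 0 then 1 else 0
  else SW

/-- The modified local growth rule of `GDA_k`: rule (2) is applied with the proviso that
if it produces a partition with `k` nonzero entries, the last entry is deleted and the
first entry is increased by `1`. -/
noncomputable def gdakRule (k : ℕ) (NW SW SE : ℕ → ℕ) (marked : Bool) : ℕ → ℕ :=
  if NW ≠ SE then fun n => max (NW n) (SE n)
  else if SW ≠ NW then
    let NE : ℕ → ℕ := fun n => NW n + if n = diffIdx SW NW + 1 then 1 else 0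
    if (∀ n, n < k → NE n ≠ 0) ∧ (∀ n, k ≤ n → NE n = 0) then
      fun n => if n = 0 then NE 0 + 1 else if n = k - 1 then 0 else NE n
    else NE
  else if marked then fun n => SW n + if n = 0 then 1 else 0
  else SW

/-- The growth diagram of a placement `P` under a given local rule: `gda rule P i j` is
the partition assigned to the lattice point `(i,j)`, i.e. the NE corner of square `(i,j)`.
Corners on the left edge (`i = 0`) and bottom edge (`j = 0`) get the empty partition. -/
noncomputable def gda (rule : (ℕ → ℕ) → (ℕ → ℕ) → (ℕ → ℕ) → Bool → (ℕ → ℕ))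
    (P : Finset Cell) : ℕ → ℕ → (ℕ → ℕ)
  | 0, _ => fun _ => 0
  | _ + 1, 0 => fun _ => 0
  | i + 1, j + 1 =>
      rule (gda rule P i (j + 1)) (gda rule P i j) (gda rule P (i + 1) j)
        (decide ((i + 1, j + 1) ∈ P))
termination_by i j => (i, j)

/-- A lattice point on the right/up border of the board `F`: the NE corner of a square of
`F` which is not an interior corner (excluding the bottom and left edges of `F`). -/
def BorderCorner (F : Finset Cell) (c : Cell) : Prop :=
  c ∈ F ∧ (c.1 + 1, c.2 + 1) ∉ F

namespace GrowthDiagram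

/-- The label on the vertical edges of a row of squares, read from left to right. The squares
satisfying `m` are marked and emit the label `r`; `u` gives the labels of the bottom edges. -/
noncomputable def carry (r : ℕ) (m : ℕ → Prop) (u : ℕ → ℕ) : ℕ → ℕ
  | 0 => 0
  | x + 1 =>
    if m (x + 1) then r
    else if u (x + 1) = carry r m u x ∧ carry r m u x ≠ 0 then carry r m u x + 1
    else carry r m u x

/-- The labels of the top edges of a row of squares whose bottom edges are labelled by `u`. -/
noncomputable def bump (r : ℕ) (m : ℕ → Prop) (u : ℕ → ℕ) : ℕ → ℕ
  | 0 => u 0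
  | x + 1 =>
    if m (x + 1) then r
    else if u (x + 1) = carry r m u x ∧ carry r m u x ≠ 0 then u (x + 1) + 1
    else u (x + 1)

/-- The labels of the horizontal edges at height `j` for the filling `M`. -/
noncomputable def state (M : ℕ → ℕ → Prop) : ℕ → ℕ → ℕ
  | 0 => fun _ => 0
  | j + 1 => bump 1 (fun x => M x (j + 1)) (state M j)

/-- The label of the top edge of the square in column `x` and row `j`. -/
noncomputable def colLab (M : ℕ → ℕ → Prop) (x j : ℕ) : ℕ := state M j x

/-- The label of the right edge of the square in column `x` and row `j`. -/
noncomputable def rowLab (M : ℕ → ℕ → Prop) (x : ℕ) : ℕ → ℕ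
  | 0 => 0
  | j + 1 => carry 1 (fun x => M x (j + 1)) (state M j) x

/-- A partial permutation: at most one marker per row and column, positive coordinates. -/
structure IsPP (M : ℕ → ℕ → Prop) : Prop where
  pos : ∀ x j, M x j → 1 ≤ x ∧ 1 ≤ j
  col : ∀ x i j, M x i → M x j → i = j
  row : ∀ x y j, M x j → M y j → x = y

section labels

variable {M M' : ℕ → ℕ → Prop}

@[simp] lemma colLab_zero_right (x : ℕ) : colLab M x 0 = 0 := rfl

@[simp] lemma rowLab_zero_right (x : ℕ) : rowLab M x 0 = 0 := rfl

@[simp] lemma colLab_zero_left (j : ℕ) : colLab M 0 j = 0 := by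
  induction j with
  | zero => rfl
  | succ j ih => exact ih

@[simp] lemma rowLab_zero_left (j : ℕ) : rowLab M 0 j = 0 := by
  cases j <;> rfl

lemma colLab_succ (x j : ℕ) : colLab M (x + 1) (j + 1) =
    if M (x + 1) (j + 1) then 1
    else if colLab M (x + 1) j = rowLab M x (j + 1) ∧ rowLab M x (j + 1) ≠ 0 then
      colLab M (x + 1) j + 1
    else colLab M (x + 1) j := rfl

lemma rowLab_succ (x j : ℕ) : rowLab M (x + 1) (j + 1) =
    if M (x + 1) (j + 1) then 1
    else if colLab M (x + 1) j = rowLab M x (j + 1) ∧ rowLab M x (j + 1) ≠ 0 then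
      rowLab M x (j + 1) + 1
    else rowLab M x (j + 1) := rfl

lemma labels_congr (x j : ℕ)
    (h : ∀ x' j', 1 ≤ x' → x' ≤ x → 1 ≤ j' → j' ≤ j → (M x' j' ↔ M' x' j')) :
    colLab M x j = colLab M' x j ∧ rowLab M x j = rowLab M' x j := by
  induction x generalizing j with
  | zero => simp
  | succ x ihx =>
    induction j with
    | zero => simp
    | succ j ihj =>
      have h1 := (ihj fun x' j' a b c d => h x' j' a b c (by omega)).1
      have h2 := (ihx (j + 1) fun x' j' a b c d => h x' j' a (by omega) c d).2
      have h3 := h (x + 1) (j + 1) (by omega) le_rfl (by omega) le_rfl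
      simp only [colLab_succ, rowLab_succ, h1, h2, h3, and_self]

lemma labels_transpose (x j : ℕ) : colLab (fun a b => M b a) j x = rowLab M x j ∧
    rowLab (fun a b => M b a) j x = colLab M x j := by
  induction x generalizing j with
  | zero => simp
  | succ x ihx =>
    induction j with
    | zero => simp
    | succ j ihj =>
      have h1 := ihj.2
      have h2 := (ihx (j + 1)).1
      simp only [colLab_succ, rowLab_succ, h1, h2]
      constructor <;> (split_ifs <;> first | rfl | omega)

lemma colLab_eq_zero (x j : ℕ) (h : ∀ j' ≤ j, ¬ M x j') : colLab M x j = 0 := by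
  induction j with
  | zero => rfl
  | succ j ih =>
    cases x with
    | zero => simp
    | succ x =>
      have h1 := ih fun j' hj => h j' (by omega)
      rw [colLab_succ, if_neg (h _ le_rfl), h1, if_neg]
      omega

lemma rowLab_eq_zero (x j : ℕ) (h : ∀ x' ≤ x, ¬ M x' j) : rowLab M x j = 0 := by
  rw [← (labels_transpose x j).1]
  exact colLab_eq_zero j x h

lemma IsPP.transpose (h : IsPP M) : IsPP fun a b => M b a :=
  ⟨fun _ _ hx => (h.pos _ _ hx).symm, fun x i j => h.row i j x, fun x y j => h.col j x y⟩

lemma IsPP.colLab_eq_zero (h : IsPP M) {x j : ℕ} (hm : M x (j + 1)) : colLab M x j = 0 :=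
  GrowthDiagram.colLab_eq_zero x j fun j' hj hm' => by
    have := h.col _ _ _ hm hm'
    omega

lemma IsPP.rowLab_eq_zero (h : IsPP M) {x j : ℕ} (hm : M (x + 1) j) : rowLab M x j = 0 :=
  GrowthDiagram.rowLab_eq_zero x j fun j' hj hm' => by
    have := h.row _ _ _ hm hm'
    omega

/-- The number of horizontal edges to the left of the corner `(x, j)` with label `n`. -/
noncomputable def shapeU (M : ℕ → ℕ → Prop) (x j n : ℕ) : ℕ :=
  ∑ y ∈ Finset.range x, if colLab M (y + 1) j = n then 1 else 0

/-- The number of vertical edges below the corner `(x, j)` with label `n`. -/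
noncomputable def shapeW (M : ℕ → ℕ → Prop) (x j n : ℕ) : ℕ :=
  ∑ i ∈ Finset.range j, if rowLab M x (i + 1) = n then 1 else 0

lemma shapeU_succ (x j n : ℕ) :
    shapeU M (x + 1) j n = shapeU M x j n + if colLab M (x + 1) j = n then 1 else 0 :=
  Finset.sum_range_succ _ _

lemma shapeW_succ (x j n : ℕ) :
    shapeW M x (j + 1) n = shapeW M x j n + if rowLab M x (j + 1) = n then 1 else 0 :=
  Finset.sum_range_succ _ _

lemma IsPP.cell_count (h : IsPP M) (x j n : ℕ) (hn : 1 ≤ n) :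
    (if rowLab M x (j + 1) = n then 1 else 0) + (if colLab M (x + 1) (j + 1) = n then 1 else 0) =
    (if colLab M (x + 1) j = n then 1 else 0) +
      (if rowLab M (x + 1) (j + 1) = n then 1 else 0) := by
  by_cases hm : M (x + 1) (j + 1)
  · have h1 := h.colLab_eq_zero hm
    have h2 := h.rowLab_eq_zero hm
    simp [colLab_succ, rowLab_succ, hm, h1, h2]
  · simp only [colLab_succ, rowLab_succ, hm, if_false]
    split_ifs <;> omega

lemma IsPP.shapeU_eq_shapeW (h : IsPP M) (x j n : ℕ) (hn : 1 ≤ n) :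
    shapeU M x j n = shapeW M x j n := by
  induction x generalizing j with
  | zero =>
    have : 0 ≠ n := by omega
    simp [shapeU, shapeW, this]
  | succ x ihx =>
    induction j with
    | zero =>
      have : 0 ≠ n := by omega
      simp [shapeU, shapeW, this]
    | succ j ihj =>
      have h0 := ihx (j + 1)
      have h1 := ihx j
      have h2 := h.cell_count x j n hn
      rw [shapeU_succ] at ihj ⊢
      rw [shapeW_succ] at h0 ⊢
      omega

end labels

/-- The filling of the grid given by a set of cells. -/
def mark (Q : Finset Cell) (x j : ℕ) : Prop := (x, j) ∈ Q

lemma diffIdx_indicator (f g : ℕ → ℕ) (m : ℕ)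
    (hg : ∀ n, g n = f n + if m = n then 1 else 0) : diffIdx f g = m := by
  have : {n | f n ≠ g n} = {m} := by
    ext n
    simp only [Set.mem_ofPred_eq, hg, Set.mem_singleton_iff]
    split_ifs <;> omega
  rw [diffIdx, this, csInf_singleton]

lemma gda_eq_shapeU (Q : Finset Cell) (h : IsPP (mark Q)) (i j : ℕ) :
    gda gdaRule Q i j = fun n => shapeU (mark Q) i j (n + 1) := by
  induction i generalizing j with
  | zero =>
    rw [gda]
    funext n
    simp [shapeU]
  | succ i ihi =>
    induction j with
    | zero =>
      rw [gda]
      funext n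
      simp [shapeU]
    | succ j ihj =>
      rw [gda, ihi (j + 1), ihi j, ihj]
      have hNW : ∀ n, shapeU (mark Q) i (j + 1) (n + 1) = shapeU (mark Q) i j (n + 1) +
          if rowLab (mark Q) i (j + 1) = n + 1 then 1 else 0 := fun n => by
        rw [h.shapeU_eq_shapeW _ _ _ (by omega), h.shapeU_eq_shapeW _ _ _ (by omega),
          shapeW_succ]
      have hSE : ∀ n, shapeU (mark Q) (i + 1) j (n + 1) = shapeU (mark Q) i j (n + 1) +
          if colLab (mark Q) (i + 1) j = n + 1 then 1 else 0 := fun n => shapeU_succ _ _ _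
      have hNE : ∀ n, shapeU (mark Q) (i + 1) (j + 1) (n + 1) =
          shapeU (mark Q) i (j + 1) (n + 1) +
          if colLab (mark Q) (i + 1) (j + 1) = n + 1 then 1 else 0 := fun n => shapeU_succ _ _ _
      have hγ := colLab_succ (M := mark Q) i j
      have hmark : mark Q (i + 1) (j + 1) →
          colLab (mark Q) (i + 1) j = 0 ∧ rowLab (mark Q) i (j + 1) = 0 :=
        fun hm => ⟨h.colLab_eq_zero hm, h.rowLab_eq_zero hm⟩
      simp only [hNE]
      simp only [hNW, hSE]
      generalize rowLab (mark Q) i (j + 1) = β at *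
      generalize colLab (mark Q) (i + 1) j = α at *
      generalize colLab (mark Q) (i + 1) (j + 1) = γ at *
      generalize shapeU (mark Q) i j = S at *
      by_cases hαβ : α = β
      · subst hαβ
        rw [gdaRule, if_neg (by simp)]
        rcases Nat.eq_zero_or_pos α with h0 | h0
        · subst h0
          by_cases hm : mark Q (i + 1) (j + 1)
          · have hm' : (i + 1, j + 1) ∈ Q := hm
            simp [hm, hm'] at hγ ⊢
            funext n
            simp [hγ]
          · have hm' : (i + 1, j + 1) ∉ Q := hm
            simp [hm, hm'] at hγ ⊢
            funext n
            simp [hγ]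
        · have hm : ¬ mark Q (i + 1) (j + 1) := fun hm => by
            have := hmark hm
            omega
          rw [if_neg hm, if_pos ⟨rfl, by omega⟩] at hγ
          have hd : diffIdx (fun n => S (n + 1))
              (fun n => S (n + 1) + if α = n + 1 then 1 else 0) = α - 1 :=
            diffIdx_indicator _ _ _ fun n => by
              congr 1
              exact if_congr (by omega) rfl rfl
          rw [if_pos, hd]
          · funext n
            congr 1
            exact if_congr (by omega) rfl rfl
          · intro heq
            have := congrFun heq (α - 1)
            rw [if_pos (by omega)] at this
            omega
      · have hm : ¬ mark Q (i + 1) (j + 1) := fun hm => by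
          have := hmark hm
          omega
        rw [if_neg hm, if_neg (by omega)] at hγ
        rw [gdaRule, if_pos]
        · funext n
          rw [hγ]
          split_ifs <;> omega
        · intro heq
          rcases Nat.eq_zero_or_pos β with h0 | h0
          · have := congrFun heq (α - 1)
            split_ifs at this <;> omega
          · have := congrFun heq (β - 1)
            split_ifs at this <;> omega

/-- The maximum of the labels on the vertical edges of abscissa `x` up to height `j`. -/
noncomputable def ht (M : ℕ → ℕ → Prop) (x : ℕ) : ℕ → ℕ
  | 0 => 0
  | j + 1 => max (ht M x j) (rowLab M x (j + 1))

section height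

variable {M : ℕ → ℕ → Prop}

@[simp] lemma ht_zero_right (x : ℕ) : ht M x 0 = 0 := rfl

lemma ht_succ_right (x j : ℕ) : ht M x (j + 1) = max (ht M x j) (rowLab M x (j + 1)) := rfl

lemma colLab_succ_le_ht (x j : ℕ) : colLab M (x + 1) j ≤ ht M x j + 1 := by
  induction j with
  | zero => simp
  | succ j ih =>
    rw [colLab_succ, ht_succ_right]
    split_ifs <;> omega

lemma IsPP.ht_succ_left (h : IsPP M) (x j : ℕ) :
    ht M (x + 1) j = max (ht M x j) (colLab M (x + 1) j) := by
  induction j with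
  | zero => simp
  | succ j ih =>
    rw [ht_succ_right, ht_succ_right, ih, colLab_succ, rowLab_succ]
    by_cases hm : M (x + 1) (j + 1)
    · simp [hm, h.colLab_eq_zero hm, h.rowLab_eq_zero hm]
    · simp only [hm, if_false]
      split_ifs <;> omega

lemma IsPP.rowLab_succ_le_ht (h : IsPP M) (x j : ℕ) : rowLab M x (j + 1) ≤ ht M x j + 1 := by
  induction x with
  | zero => simp
  | succ x ih =>
    rw [rowLab_succ, h.ht_succ_left]
    split_ifs <;> omega

lemma IsPP.ht_zero_left (j : ℕ) : ht M 0 j = 0 := by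
  induction j with
  | zero => rfl
  | succ j ih => simp [ht_succ_right, ih]

lemma IsPP.exists_colLab_eq_ht (h : IsPP M) {x j : ℕ} (hx : 1 ≤ ht M x j) :
    ∃ y, 1 ≤ y ∧ y ≤ x ∧ colLab M y j = ht M x j := by
  induction x with
  | zero => simp [IsPP.ht_zero_left] at hx
  | succ x ih =>
    rw [h.ht_succ_left] at hx ⊢
    rcases le_total (ht M x j) (colLab M (x + 1) j) with hle | hle
    · exact ⟨x + 1, by omega, le_rfl, by rw [max_eq_right hle]⟩
    · rw [max_eq_left hle] at hx ⊢
      obtain ⟨y, h1, h2, h3⟩ := ih hx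
      exact ⟨y, h1, by omega, h3⟩

lemma IsPP.colLab_le_ht (h : IsPP M) {x y : ℕ} (j : ℕ) (hy : y ≤ x) :
    colLab M y j ≤ ht M x j := by
  induction x with
  | zero => simp [Nat.le_zero.1 hy]
  | succ x ih =>
    rw [h.ht_succ_left]
    rcases Nat.lt_or_ge y (x + 1) with hlt | hge
    · exact (ih (by omega)).trans (le_max_left _ _)
    · rw [show y = x + 1 by omega]
      exact le_max_right _ _

end height

/-- Insertion of the letter `c`: one row of squares with a marker in column `c`. -/
noncomputable def insL (c : ℕ) (u : ℕ → ℕ) : ℕ → ℕ := bump 1 (· = c) u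

/-- Successive insertion of the letters of a word. -/
noncomputable def run (w : List ℕ) (u : ℕ → ℕ) : ℕ → ℕ := w.foldl (fun u c => insL c u) u

lemma run_append (v w : List ℕ) (u : ℕ → ℕ) : run (v ++ w) u = run w (run v u) :=
  List.foldl_append

lemma insL_eq_zero {c x : ℕ} {u : ℕ → ℕ} (hx : x ≠ c) (hu : u x = 0) : insL c u x = 0 := by
  cases x with
  | zero => exact hu
  | succ x =>
    rw [insL, bump, if_neg hx, hu, if_neg]
    omega

lemma run_eq_zero {w : List ℕ} {x : ℕ} {u : ℕ → ℕ} (hx : x ∉ w) (hu : u x = 0) :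
    run w u x = 0 := by
  induction w generalizing u with
  | nil => exact hu
  | cons c w ih =>
    rw [List.mem_cons, not_or] at hx
    exact ih hx.2 (insL_eq_zero hx.1 hu)

/-- Knuth equivalence of words in distinct letters. -/
inductive Kn : List ℕ → List ℕ → Prop
  | refl (w) : Kn w w
  | symm {v w} : Kn v w → Kn w v
  | trans {u v w} : Kn u v → Kn v w → Kn u w
  | k1 (a b) {x y z} : x < y → y < z → Kn (a ++ [y, x, z] ++ b) (a ++ [y, z, x] ++ b)
  | k2 (a b) {x y z} : x < y → y < z → Kn (a ++ [x, z, y] ++ b) (a ++ [z, x, y] ++ b)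

lemma Kn.context {v w : List ℕ} (h : Kn v w) (a b : List ℕ) : Kn (a ++ v ++ b) (a ++ w ++ b) := by
  induction h with
  | refl => exact .refl _
  | symm _ ih => exact .symm ih
  | trans _ _ ih1 ih2 => exact .trans ih1 ih2
  | k1 c d h1 h2 => simpa using Kn.k1 (a ++ c) (d ++ b) h1 h2
  | k2 c d h1 h2 => simpa using Kn.k2 (a ++ c) (d ++ b) h1 h2

lemma Kn.append_right {v w : List ℕ} (h : Kn v w) (b : List ℕ) : Kn (v ++ b) (w ++ b) := by
  simpa using h.context [] b

lemma Kn.append_left {v w : List ℕ} (h : Kn v w) (a : List ℕ) : Kn (a ++ v) (a ++ w) := by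
  simpa using h.context a []

lemma Kn.perm {v w : List ℕ} (h : Kn v w) : v.Perm w := by
  induction h with
  | refl => exact .refl _
  | symm _ ih => exact ih.symm
  | trans _ _ ih1 ih2 => exact ih1.trans ih2
  | k1 a b _ _ => exact (((List.Perm.swap _ _ _).cons _).append_left a).append_right b
  | k2 a b _ _ => exact ((List.Perm.swap _ _ _).append_left a).append_right b

/-- The row label emitted by column `t` during the insertion of `c`. -/
noncomputable def cr (c : ℕ) (u : ℕ → ℕ) (t : ℕ) : ℕ := carry 1 (· = c) u t

lemma cr_succ (c : ℕ) (u : ℕ → ℕ) (t : ℕ) : cr c u (t + 1) =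
    if t + 1 = c then 1 else if u (t + 1) = cr c u t ∧ cr c u t ≠ 0 then cr c u t + 1
    else cr c u t := by
  rw [cr, carry]
  congr

lemma insL_succ (c : ℕ) (u : ℕ → ℕ) (t : ℕ) : insL c u (t + 1) =
    if t + 1 = c then 1 else if u (t + 1) = cr c u t ∧ cr c u t ≠ 0 then u (t + 1) + 1
    else u (t + 1) := by
  rw [insL, bump]
  congr

lemma run_k1 {x y z : ℕ} {u : ℕ → ℕ} (hxy : x < y) (hyz : y < z) (hx1 : 1 ≤ x)
    (hx : u x = 0) (hy : u y = 0) (hz : u z = 0) : run [y, x, z] u = run [y, z, x] u := by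
  suffices H : ∀ t, insL z (insL x (insL y u)) t = insL x (insL z (insL y u)) t ∧
      cr x (insL y u) t = cr x (insL z (insL y u)) t ∧
      cr z (insL x (insL y u)) t = cr z (insL y u) t ∧
      cr z (insL y u) t ≤ cr y u t ∧
      (cr y u t = 0 ∨ cr y u t < cr x (insL y u) t) ∧
      (t < x → cr x (insL y u) t = 0) ∧ (x ≤ t → 1 ≤ cr x (insL y u) t) ∧
      (t < y → cr y u t = 0) ∧ (y ≤ t → 1 ≤ cr y u t) ∧
      (t < z → cr z (insL y u) t = 0) from funext fun t => (H t).1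
  intro t
  induction t with
  | zero =>
    refine ⟨rfl, rfl, rfl, le_rfl, .inl rfl, fun _ => rfl, ?_, fun _ => rfl, ?_, fun _ => rfl⟩ <;>
    omega
  | succ t ih =>
    have hv : t + 1 = x ∨ t + 1 = y ∨ t + 1 = z → u (t + 1) = 0 := by
      rintro (h | h | h) <;> rw [h] <;> assumption
    obtain ⟨-, h1, h2, h3, h4, h5, h6, h7, h8, h9⟩ := ih
    have e1 := cr_succ y u t
    have e2 := cr_succ x (insL y u) t
    have e3 := cr_succ z (insL y u) t
    have e4 := cr_succ z (insL x (insL y u)) t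
    have e5 := cr_succ x (insL z (insL y u)) t
    have f1 := insL_succ y u t
    have f2 := insL_succ x (insL y u) t
    have f3 := insL_succ z (insL y u) t
    have f4 := insL_succ z (insL x (insL y u)) t
    have f5 := insL_succ x (insL z (insL y u)) t
    rw [← h1] at e5 f5
    rw [h2] at e4 f4
    clear h1 h2 hx hy hz
    generalize insL z (insL x (insL y u)) (t + 1) = v4 at *
    generalize insL x (insL z (insL y u)) (t + 1) = v5 at *
    generalize cr z (insL x (insL y u)) (t + 1) = g4 at *
    generalize cr x (insL z (insL y u)) (t + 1) = g5 at *
    generalize insL x (insL y u) (t + 1) = v2 at *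
    generalize insL z (insL y u) (t + 1) = v3 at *
    generalize cr x (insL y u) (t + 1) = b' at *
    generalize cr z (insL y u) (t + 1) = g' at *
    generalize cr x (insL y u) t = b at *
    generalize cr z (insL y u) t = g at *
    generalize insL y u (t + 1) = v1 at *
    generalize cr y u (t + 1) = a' at *
    generalize cr y u t = a at *
    generalize u (t + 1) = v at *
    rcases (by omega : t + 1 = x ∨ t + 1 = y ∨ t + 1 = z ∨ (t + 1 ≠ x ∧ t + 1 ≠ y ∧ t + 1 ≠ z))
      with h | h | h | h
    · obtain rfl := hv (by omega)
      obtain rfl := h7 (by omega)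
      obtain rfl := h5 (by omega)
      obtain rfl := h9 (by omega)
      simp [h, hxy.ne, (hxy.trans hyz).ne] at e1 f1 e2 f2 e3 f3 e4 f4 e5 f5
      omega
    · obtain rfl := hv (by omega)
      obtain rfl := h7 (by omega)
      obtain rfl := h9 (by omega)
      simp only [h, hxy.ne', hyz.ne, if_true, if_false] at e1 f1 e2 f2 e3 f3 e4 f4 e5 f5
      subst e1 f1
      simp at e3 f3 e4 f4
      subst e3 f3
      split_ifs at e2 f2 e5 f5 <;> omega
    · obtain rfl := hv (by omega)
      simp only [h, hyz.ne', (hxy.trans hyz).ne', if_true, if_false]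
        at e1 f1 e2 f2 e3 f3 e4 f4 e5 f5
      rw [if_neg (by omega)] at e1 f1
      subst e1 f1
      rw [if_neg (by omega)] at e2 f2
      subst e2 f2 f3
      rw [if_neg (by omega)] at e5 f5
      refine ⟨?_, ?_, ?_, ?_, ?_, ?_, ?_, ?_, ?_, ?_⟩ <;> omega
    · simp only [h, if_false] at e1 f1 e2 f2 e3 f3 e4 f4 e5 f5
      clear hv
      have hw : (a' = a ∧ v1 = v ∧ (v ≠ a ∨ a = 0)) ∨ (a' = a + 1 ∧ v1 = v + 1 ∧ v = a ∧ a ≠ 0) := by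
        split_ifs at e1 f1 <;> omega
      clear e1 f1
      by_cases hb : v1 = b ∧ b ≠ 0 <;> by_cases hg : v1 = g ∧ g ≠ 0
      · omega
      · rw [if_pos hb] at e2 f2
        rw [if_neg hg] at e3 f3
        rw [if_neg (by omega)] at e4 f4
        rw [if_pos (by omega)] at e5 f5
        refine ⟨?_, ?_, ?_, ?_, ?_, ?_, ?_, ?_, ?_, ?_⟩ <;> omega
      · rw [if_neg hb] at e2 f2
        rw [if_pos hg] at e3 f3
        rw [if_pos (by omega)] at e4 f4
        rw [if_neg (by omega)] at e5 f5
        refine ⟨?_, ?_, ?_, ?_, ?_, ?_, ?_, ?_, ?_, ?_⟩ <;> omega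
      · rw [if_neg hb] at e2 f2
        rw [if_neg hg] at e3 f3
        rw [if_neg (by omega)] at e4 f4
        rw [if_neg (by omega)] at e5 f5
        refine ⟨?_, ?_, ?_, ?_, ?_, ?_, ?_, ?_, ?_, ?_⟩ <;> omega

lemma run_k2 {x y z : ℕ} {u : ℕ → ℕ} (hxy : x < y) (hyz : y < z) (hx1 : 1 ≤ x)
    (hx : u x = 0) (hy : u y = 0) (hz : u z = 0) : run [x, z, y] u = run [z, x, y] u := by
  suffices H : ∀ t, insL y (insL z (insL x u)) t = insL y (insL x (insL z u)) t ∧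
      ((cr z u t = cr z (insL x u) t ∧ cr x (insL z u) t = cr x u t ∧
        cr y (insL x (insL z u)) t = cr y (insL z (insL x u)) t ∧
        (cr z (insL x u) t < cr y (insL z (insL x u)) t ∨
          cr z (insL x u) t = 0 ∧ cr y (insL z (insL x u)) t = 0) ∧
        cr y (insL z (insL x u)) t ≤ cr x u t) ∨
      (cr z u t = cr x u t ∧ cr x (insL z u) t = cr y (insL z (insL x u)) t ∧
        cr y (insL x (insL z u)) t = cr z (insL x u) t ∧
        cr z (insL x u) t ≤ cr x u t ∧ cr x u t < cr y (insL z (insL x u)) t ∧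
        z ≤ t ∧ 1 ≤ cr z (insL x u) t)) ∧
      (t < x → cr x u t = 0) ∧ (x ≤ t → 1 ≤ cr x u t) ∧
      (t < y → cr y (insL z (insL x u)) t = 0) ∧ (y ≤ t → 1 ≤ cr y (insL z (insL x u)) t) ∧
      (t < z → cr z (insL x u) t = 0) from funext fun t => (H t).1
  intro t
  induction t with
  | zero =>
    refine ⟨rfl, .inl ⟨rfl, rfl, rfl, .inr ⟨rfl, rfl⟩, le_rfl⟩, fun _ => rfl, ?_, fun _ => rfl, ?_,
      fun _ => rfl⟩ <;> omega
  | succ t ih =>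
    have hv : t + 1 = x ∨ t + 1 = y ∨ t + 1 = z → u (t + 1) = 0 := by
      rintro (h | h | h) <;> rw [h] <;> assumption
    obtain ⟨-, h0, h5, h6, h7, h8, h9⟩ := ih
    have e1 := cr_succ x u t
    have e2 := cr_succ z (insL x u) t
    have e3 := cr_succ y (insL z (insL x u)) t
    have e4 := cr_succ z u t
    have e5 := cr_succ x (insL z u) t
    have e6 := cr_succ y (insL x (insL z u)) t
    have f1 := insL_succ x u t
    have f2 := insL_succ z (insL x u) t
    have f3 := insL_succ y (insL z (insL x u)) t
    have f4 := insL_succ z u t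
    have f5 := insL_succ x (insL z u) t
    have f6 := insL_succ y (insL x (insL z u)) t
    clear hx hy hz
    generalize insL y (insL z (insL x u)) (t + 1) = v3 at *
    generalize insL y (insL x (insL z u)) (t + 1) = v6 at *
    generalize cr y (insL z (insL x u)) (t + 1) = g' at *
    generalize cr y (insL x (insL z u)) (t + 1) = g2' at *
    generalize cr y (insL z (insL x u)) t = g at *
    generalize cr y (insL x (insL z u)) t = g2 at *
    generalize insL z (insL x u) (t + 1) = v2 at *
    generalize insL x (insL z u) (t + 1) = v5 at *
    generalize cr z (insL x u) (t + 1) = b' at *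
    generalize cr x (insL z u) (t + 1) = b2' at *
    generalize cr z (insL x u) t = b at *
    generalize cr x (insL z u) t = b2 at *
    generalize insL x u (t + 1) = v1 at *
    generalize insL z u (t + 1) = v4 at *
    generalize cr x u (t + 1) = a' at *
    generalize cr z u (t + 1) = a2' at *
    generalize cr x u t = a at *
    generalize cr z u t = a2 at *
    generalize u (t + 1) = v at *
    rcases (by omega : t + 1 = x ∨ t + 1 = y ∨ t + 1 = z ∨ (t + 1 ≠ x ∧ t + 1 ≠ y ∧ t + 1 ≠ z))
      with h | h | h | h
    · obtain rfl := hv (by omega)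
      obtain rfl := h5 (by omega)
      obtain rfl := h7 (by omega)
      obtain rfl := h9 (by omega)
      obtain ⟨rfl, rfl, rfl⟩ : a2 = 0 ∧ b2 = 0 ∧ g2 = 0 := by omega
      simp [h, hxy.ne, (hxy.trans hyz).ne] at e1 f1 e2 f2 e3 f3 e4 f4 e5 f5 e6 f6
      omega
    · obtain rfl := hv (by omega)
      obtain rfl := h7 (by omega)
      obtain rfl := h9 (by omega)
      have h6 := h6 (by omega)
      obtain ⟨rfl, rfl, rfl⟩ : a2 = 0 ∧ b2 = a ∧ g2 = 0 := by omega
      have hb : b2 ≠ 0 := by omega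
      simp [h, hxy.ne', hyz.ne, hb.symm] at e1 f1 e2 f2 e3 f3 e4 f4 e5 f5 e6 f6
      subst f4
      rw [if_neg (by omega)] at e5 f5
      omega
    · obtain rfl := hv (by omega)
      obtain rfl := h9 (by omega)
      have h6 := h6 (by omega)
      have h8 := h8 (by omega)
      obtain ⟨rfl, hb, hg⟩ : a2 = 0 ∧ b2 = a ∧ g2 = g := by omega
      simp only [h, hyz.ne', (hxy.trans hyz).ne', if_true, if_false]
        at e1 f1 e2 f2 e3 f3 e4 f4 e5 f5 e6 f6
      rw [if_neg (by omega)] at e1 f1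
      subst e1 f1 e2 f2 e4 f4
      by_cases ha : a' = 1
      · rw [if_pos (by omega)] at e3 f3 e5 f5
        rw [if_neg (by omega)] at e6 f6
        omega
      · rw [if_neg (by omega)] at e5 f5
        split_ifs at e3 f3 e6 f6 <;> omega
    · simp only [h, if_false] at e1 f1 e2 f2 e3 f3 e4 f4 e5 f5 e6 f6
      clear hv
      rcases h0 with ⟨rfl, rfl, rfl, h1, h2⟩ | ⟨rfl, rfl, rfl, h1, h2, h3, h4⟩
      · by_cases ha : v = b2 ∧ b2 ≠ 0
        · rw [if_pos ha] at e1 f1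
          rw [if_neg (by omega)] at e2 f2
          rw [if_neg (by omega)] at e3 f3
          rw [if_neg (by omega)] at e4 f4
          rw [if_pos (by omega)] at e5 f5
          rw [if_neg (by omega)] at e6 f6
          omega
        · rw [if_neg ha] at e1 f1
          by_cases hb : v = a2 ∧ a2 ≠ 0
          · rw [if_pos (by omega)] at e2 f2 e4 f4
            by_cases hb2 : b2 = a2 + 1
            · rw [if_pos (by omega)] at e3 f3 e5 f5
              rw [if_neg (by omega)] at e6 f6
              omega
            · rw [if_neg (by omega)] at e5 f5
              by_cases hg : g2 = a2 + 1
              · rw [if_pos (by omega)] at e3 f3 e6 f6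
                omega
              · rw [if_neg (by omega)] at e3 f3 e6 f6
                omega
          · rw [if_neg (by omega)] at e2 f2 e4 f4 e5 f5
            by_cases hg : v = g2 ∧ g2 ≠ 0
            · rw [if_pos (by omega)] at e3 f3 e6 f6
              omega
            · rw [if_neg (by omega)] at e3 f3 e6 f6
              omega
      · by_cases ha : v = a2
        · rw [if_pos (by omega)] at e1 f1 e4 f4
          rw [if_neg (by omega)] at e2 f2
          by_cases hg : b2 = a2 + 1
          · rw [if_pos (by omega)] at e3 f3 e5 f5
            rw [if_neg (by omega)] at e6 f6
            omega
          · rw [if_neg (by omega)] at e3 f3 e5 f5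
            rw [if_neg (by omega)] at e6 f6
            omega
        · rw [if_neg (by omega)] at e1 f1 e4 f4
          by_cases hb : v = g2
          · rw [if_pos (by omega)] at e2 f2
            rw [if_neg (by omega)] at e3 f3 e5 f5
            rw [if_pos (by omega)] at e6 f6
            omega
          · rw [if_neg (by omega)] at e2 f2
            by_cases hg : v = b2
            · rw [if_pos (by omega)] at e3 f3 e5 f5
              rw [if_neg (by omega)] at e6 f6
              omega
            · rw [if_neg (by omega)] at e3 f3 e5 f5
              rw [if_neg (by omega)] at e6 f6
              omega

lemma Kn.run_eq {v w : List ℕ} (h : Kn v w) {u : ℕ → ℕ} (hn : v.Nodup)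
    (hv : ∀ c ∈ v, 1 ≤ c ∧ u c = 0) : run v u = run w u := by
  induction h with
  | refl => rfl
  | symm h ih =>
    exact (ih (h.perm.nodup_iff.2 hn) fun c hc => hv c (h.perm.mem_iff.1 hc)).symm
  | trans h _ ih1 ih2 =>
    exact (ih1 hn hv).trans
      (ih2 (h.perm.nodup_iff.1 hn) fun c hc => hv c (h.perm.mem_iff.2 hc))
  | k1 a b h1 h2 =>
    have hz : ∀ c ∈ [_, _, _], run a u c = 0 := fun c hc =>
      run_eq_zero (fun hca => (List.disjoint_of_nodup_append (List.nodup_append.1 hn).1) hca hc)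
        (hv c (by simp at hc ⊢; tauto)).2
    rw [run_append, run_append, run_append, run_append,
      run_k1 h1 h2 (hv _ (by simp)).1 (hz _ (by simp)) (hz _ (by simp)) (hz _ (by simp))]
  | k2 a b h1 h2 =>
    have hz : ∀ c ∈ [_, _, _], run a u c = 0 := fun c hc =>
      run_eq_zero (fun hca => (List.disjoint_of_nodup_append (List.nodup_append.1 hn).1) hca hc)
        (hv c (by simp at hc ⊢; tauto)).2
    rw [run_append, run_append, run_append, run_append,
      run_k2 h1 h2 (hv _ (by simp)).1 (hz _ (by simp)) (hz _ (by simp)) (hz _ (by simp))]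

lemma Kn.bump_row_right {c e : ℕ} {M : List ℕ} (hce : c < e) (hM : (e :: M).Pairwise (· < ·)) :
    Kn (e :: M ++ [c]) (e :: c :: M) := by
  induction M generalizing e with
  | nil => exact .refl _
  | cons m M ih =>
    rw [List.pairwise_cons] at hM
    have hem := hM.1 m (by simp)
    have h1 := (ih (hce.trans hem) hM.2).append_left [e]
    have h2 := (Kn.k1 [] M hce hem).symm
    exact (by simpa using h1 : Kn (e :: m :: M ++ [c]) (e :: m :: c :: M)).trans
      (by simpa using h2)

lemma Kn.bump_row_left {c e : ℕ} {L : List ℕ} (hce : c < e)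
    (hL : (L ++ [c]).Pairwise (· < ·)) : Kn (L ++ [e, c]) (e :: L ++ [c]) := by
  induction L with
  | nil => exact .refl _
  | cons l L ih =>
    rw [List.cons_append, List.pairwise_cons] at hL
    have h1 := (ih hL.2).append_left [l]
    refine (by simpa using h1 : Kn (l :: L ++ [e, c]) (l :: e :: (L ++ [c]))).trans ?_
    cases L with
    | nil => simpa using Kn.k2 [] [] (hL.1 c (by simp)) hce
    | cons l' L =>
      have h2 : l' < e := by
        have := (List.pairwise_append.1 hL.2).2.2 l' (by simp) c (by simp)
        omega
      simpa using Kn.k2 [] (L ++ [c]) (hL.1 l' (by simp)) h2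

lemma Kn.bump_row {c e : ℕ} {L M : List ℕ} (hce : c < e)
    (hL : (L ++ [c]).Pairwise (· < ·)) (hM : (e :: M).Pairwise (· < ·)) :
    Kn (L ++ e :: M ++ [c]) (e :: L ++ c :: M) := by
  have h1 := (Kn.bump_row_right hce hM).append_left L
  have h2 := (Kn.bump_row_left hce hL).append_right M
  exact (by simpa using h1 : Kn _ (L ++ [e, c] ++ M)).trans (by simpa using h2)

section insertion

lemma carry_of_lt {r c t : ℕ} (u : ℕ → ℕ) (h : t < c) : carry r (· = c) u t = 0 := by
  induction t with
  | zero => rfl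
  | succ t ih => simp [carry, ih (by omega), h.ne]

lemma carry_of_le {r c t : ℕ} {u : ℕ → ℕ} (hc : 1 ≤ c) (h : c ≤ t)
    (hu : ∀ x, c < x → x ≤ t → u x ≠ r) : carry r (· = c) u t = r := by
  induction t with
  | zero => omega
  | succ t ih =>
    rw [carry]
    by_cases hct : t + 1 = c
    · rw [if_pos hct]
    · rw [if_neg hct, ih (by omega) fun x h1 h2 => hu x h1 (by omega), if_neg]
      exact fun h' => hu _ (by omega) le_rfl h'.1

lemma carry_eq_zero_or_le (r : ℕ) (m : ℕ → Prop) (u : ℕ → ℕ) (t : ℕ) :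
    carry r m u t = 0 ∨ r ≤ carry r m u t := by
  induction t with
  | zero => exact .inl rfl
  | succ t ih =>
    rw [carry]
    split_ifs <;> omega

lemma bump_of_lt {r c t : ℕ} (u : ℕ → ℕ) (h : t < c) : bump r (· = c) u t = u t := by
  cases t with
  | zero => rfl
  | succ t => simp [bump, carry_of_lt u (show t < c by omega), h.ne]

lemma bump_self {r c : ℕ} (u : ℕ → ℕ) (hc : 1 ≤ c) : bump r (· = c) u c = r := by
  obtain ⟨c, rfl⟩ : ∃ d, c = d + 1 := ⟨c - 1, by omega⟩
  simp [bump]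

lemma bump_eq_of_lt {r c t : ℕ} {u : ℕ → ℕ} (htc : t ≠ c) (h : u t < r) :
    bump r (· = c) u t = u t := by
  cases t with
  | zero => rfl
  | succ t =>
    have := carry_eq_zero_or_le r (· = c) u t
    rw [bump, if_neg htc, if_neg]
    omega

lemma le_bump {r c t : ℕ} {u : ℕ → ℕ} (h : r ≤ u t) : r ≤ bump r (· = c) u t := by
  cases t with
  | zero => exact h
  | succ t =>
    rw [bump]
    split_ifs <;> omega

lemma bump_eq_update {r c : ℕ} {u : ℕ → ℕ} (hc : 1 ≤ c) (hu : ∀ x, c < x → u x ≠ r) :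
    bump r (· = c) u = Function.update u c r := by
  funext t
  rcases lt_trichotomy t c with h | rfl | h
  · rw [bump_of_lt u h, Function.update_of_ne h.ne]
  · rw [bump_self u hc, Function.update_self]
  · rw [Function.update_of_ne h.ne']
    obtain ⟨t, rfl⟩ : ∃ d, t = d + 1 := ⟨t - 1, by omega⟩
    rw [bump, if_neg h.ne', carry_of_le hc (by omega) fun x h1 _ => hu x h1, if_neg]
    exact fun h' => hu _ h h'.1

lemma bump_eq_bump_succ {r c e : ℕ} {u : ℕ → ℕ} (hr : 1 ≤ r) (hc : 1 ≤ c) (hce : c < e)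
    (he : u e = r) (hu : ∀ x, c < x → x < e → u x ≠ r) :
    bump r (· = c) u = bump (r + 1) (· = e) (Function.update u c r) := by
  have hcarry : ∀ t, e ≤ t →
      carry r (· = c) u t = carry (r + 1) (· = e) (Function.update u c r) t := by
    intro t ht
    induction t with
    | zero => omega
    | succ t ih =>
      rw [carry, carry, Function.update_of_ne (by omega), if_neg (by omega)]
      rcases ht.eq_or_lt with h | h
      · rw [if_pos h.symm, ← h, carry_of_le hc (by omega) fun x h1 h2 => hu x h1 (by omega),
          if_pos ⟨he, by omega⟩]
      · rw [if_neg h.ne', ih (by omega)]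
  funext t
  rcases lt_trichotomy t e with h | h | h
  · rw [bump_of_lt _ h]
    rcases lt_trichotomy t c with h' | rfl | h'
    · rw [bump_of_lt u h', Function.update_of_ne h'.ne]
    · rw [bump_self u hc, Function.update_self]
    · rw [Function.update_of_ne h'.ne']
      obtain ⟨t, rfl⟩ : ∃ d, t = d + 1 := ⟨t - 1, by omega⟩
      rw [bump, if_neg h'.ne',
        carry_of_le hc (by omega) fun x h1 h2 => hu x h1 (by omega), if_neg]
      exact fun h'' => hu _ h' h h''.1
  · subst h
    rw [bump_self _ (by omega)]
    obtain ⟨t, rfl⟩ : ∃ d, t = d + 1 := ⟨t - 1, by omega⟩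
    rw [bump, if_neg hce.ne', carry_of_le hc (by omega) fun x h1 h2 => hu x h1 (by omega),
      if_pos ⟨he, by omega⟩, he]
  · obtain ⟨t, rfl⟩ : ∃ d, t = d + 1 := ⟨t - 1, by omega⟩
    rw [bump, bump, if_neg (by omega), if_neg h.ne', hcarry t (by omega),
      Function.update_of_ne (by omega)]

end insertion

/-- The columns `x ≤ X` with label `r`, in increasing order. -/
noncomputable def rowWord (X : ℕ) (u : ℕ → ℕ) (r : ℕ) : List ℕ :=
  (List.range (X + 1)).filter (u · = r)

/-- The row reading word, from top to bottom, of the tableau whose row `s`, for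
`r ≤ s < r + m`, consists of the columns with label `s`. -/
noncomputable def readWord (X : ℕ) (u : ℕ → ℕ) (r : ℕ) : ℕ → List ℕ
  | 0 => []
  | m + 1 => readWord X u (r + 1) m ++ rowWord X u r

section reading

variable {X : ℕ}

lemma mem_rowWord {u : ℕ → ℕ} {r x : ℕ} : x ∈ rowWord X u r ↔ x ≤ X ∧ u x = r := by
  simp [rowWord]

lemma pairwise_rowWord (u : ℕ → ℕ) (r : ℕ) : (rowWord X u r).Pairwise (· < ·) :=
  List.pairwise_lt_range.filter _

lemma rowWord_eq {u : ℕ → ℕ} {r : ℕ} {l : List ℕ} (hl : l.Pairwise (· < ·))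
    (h : ∀ x, x ∈ l ↔ x ≤ X ∧ u x = r) : rowWord X u r = l := by
  refine List.Perm.eq_of_pairwise (le := (· < ·)) (fun a b _ _ h1 h2 => absurd h1 h2.asymm)
    (pairwise_rowWord u r) hl ?_
  rw [List.perm_ext_iff_of_nodup ((pairwise_rowWord u r).imp fun h => h.ne)
    (hl.imp fun h => h.ne)]
  intro x
  rw [mem_rowWord, h]

lemma rowWord_congr {u u' : ℕ → ℕ} {r : ℕ} (h : ∀ x ≤ X, u x = r ↔ u' x = r) :
    rowWord X u r = rowWord X u' r :=
  rowWord_eq (pairwise_rowWord u' r) fun x => by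
    rw [mem_rowWord]
    exact and_congr_right fun hx => (h x hx).symm

lemma readWord_congr {u u' : ℕ → ℕ} {r : ℕ} (m : ℕ)
    (h : ∀ x ≤ X, ∀ s, r ≤ s → (u x = s ↔ u' x = s)) : readWord X u r m = readWord X u' r m := by
  induction m generalizing r with
  | zero => rfl
  | succ m ih =>
    rw [readWord, readWord, ih fun x hx s hs => h x hx s (by omega),
      rowWord_congr fun x hx => h x hx r le_rfl]

lemma Kn.readWord_bump {c r H : ℕ} {u : ℕ → ℕ} (hr : 1 ≤ r) (hc : 1 ≤ c) (hcX : c ≤ X)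
    (hur : u c < r) (hH : X + 1 ≤ H + c) (hX : ∀ x, X < x → u x = 0) :
    Kn (readWord X u r H ++ [c]) (readWord X (bump r (· = c) u) r H) := by
  induction H generalizing c r u with
  | zero => omega
  | succ H ih =>
    by_cases hex : ∃ e, c < e ∧ u e = r
    · let e := Nat.find hex
      obtain ⟨hce, he⟩ : c < e ∧ u e = r := Nat.find_spec hex
      have hmin : ∀ x, c < x → x < e → u x ≠ r := fun x h1 h2 h3 =>
        Nat.find_min hex h2 ⟨h1, h3⟩
      have heX : e ≤ X := by
        by_contra h
        have := hX e (by omega)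
        omega
      set L := (List.range (X + 1)).filter fun x => u x = r ∧ x < c with hL
      set M := (List.range (X + 1)).filter fun x => u x = r ∧ e < x with hM
      have hLp : L.Pairwise (· < ·) := List.pairwise_lt_range.filter _
      have hMp : M.Pairwise (· < ·) := List.pairwise_lt_range.filter _
      have hLm : ∀ x, x ∈ L ↔ x ≤ X ∧ u x = r ∧ x < c := by simp [hL]
      have hMm : ∀ x, x ∈ M ↔ x ≤ X ∧ u x = r ∧ e < x := by simp [hM]
      have hrow : rowWord X u r = L ++ e :: M := by
        refine rowWord_eq ?_ fun x => ?_
        · refine List.pairwise_append.2 ⟨hLp, List.pairwise_cons.2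
            ⟨fun x hx => ((hMm x).1 hx).2.2, hMp⟩, fun x hx y hy => ?_⟩
          have := (hLm x).1 hx
          rcases List.mem_cons.1 hy with rfl | hy
          · omega
          · have := (hMm y).1 hy
            omega
        · rw [List.mem_append, List.mem_cons, hLm, hMm]
          constructor
          · rintro (h | rfl | h)
            exacts [⟨h.1, h.2.1⟩, ⟨heX, he⟩, ⟨h.1, h.2.1⟩]
          · rintro ⟨h1, h2⟩
            have h3 := hmin x
            have h4 : x ≠ c := by
              rintro rfl
              omega
            have : x < c ∨ (c < x ∧ x < e) ∨ x = e ∨ e < x := by omega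
            tauto
      set u' := Function.update u c r with hu'
      have hne : ∀ x, x ≠ c → u' x = u x := fun x hx => Function.update_of_ne hx _ _
      have hself : u' c = r := Function.update_self _ _ _
      have hb : bump r (· = c) u = bump (r + 1) (· = e) u' := bump_eq_bump_succ hr hc hce he hmin
      have hrow' : rowWord X (bump (r + 1) (· = e) u') r = L ++ c :: M := by
        refine rowWord_eq ?_ fun x => ?_
        · refine List.pairwise_append.2 ⟨hLp, List.pairwise_cons.2
            ⟨fun x hx => hce.trans ((hMm x).1 hx).2.2, hMp⟩, fun x hx y hy => ?_⟩
          have := (hLm x).1 hx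
          rcases List.mem_cons.1 hy with rfl | hy
          · omega
          · have := (hMm y).1 hy
            omega
        · have hval : bump (r + 1) (· = e) u' x = r ↔ x ≠ e ∧ u' x = r := by
            rcases eq_or_ne x e with rfl | hxe
            · simp [bump_self u' (show 1 ≤ e by omega)]
            · rcases Nat.lt_or_ge (u' x) (r + 1) with h | h
              · simp [bump_eq_of_lt hxe h, hxe]
              · have := le_bump (c := e) h
                constructor <;> intro <;> omega
          rw [List.mem_append, List.mem_cons, hLm, hMm, hval]
          rcases eq_or_ne x c with rfl | hxc
          · simp [hself, hce.ne, hcX]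
          · rw [hne x hxc]
            have h3 := hmin x
            constructor
            · rintro (h | h | h)
              exacts [⟨h.1, by omega, h.2.1⟩, absurd h hxc, ⟨h.1, by omega, h.2.1⟩]
            · rintro ⟨h1, h2, h4⟩
              have : x < c ∨ (c < x ∧ x < e) ∨ e < x := by omega
              tauto
      have hread : readWord X u (r + 1) H = readWord X u' (r + 1) H :=
        readWord_congr _ fun x _ s hs => by
          rcases eq_or_ne x c with rfl | hxc
          · constructor <;> intro <;> omega
          · rw [hne x hxc]
      have hIH := ih (c := e) (r := r + 1) (u := u') (by omega) (by omega) heX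
        (by rw [hne e hce.ne', he]; omega) (by omega)
        fun x hx => by rw [hne x (by omega), hX x hx]
      have hLc : (L ++ [c]).Pairwise (· < ·) := List.pairwise_append.2
        ⟨hLp, List.pairwise_singleton _ _, fun x hx y hy => by
          rw [List.mem_singleton.1 hy]
          exact ((hLm x).1 hx).2.2⟩
      have heM : (e :: M).Pairwise (· < ·) :=
        List.pairwise_cons.2 ⟨fun x hx => ((hMm x).1 hx).2.2, hMp⟩
      rw [readWord, readWord, hb, hrow, hrow', hread]
      have h1 := (Kn.bump_row hce hLc heM).append_left (readWord X u' (r + 1) H)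
      have h2 := hIH.append_right (L ++ c :: M)
      have h3 : Kn (readWord X u' (r + 1) H ++ (L ++ e :: M) ++ [c])
          (readWord X u' (r + 1) H ++ [e] ++ (L ++ c :: M)) := by simpa using h1
      exact h3.trans h2
    · push Not at hex
      rw [bump_eq_update hc hex, readWord, readWord]
      have h1 : readWord X (Function.update u c r) (r + 1) H = readWord X u (r + 1) H :=
        readWord_congr _ fun x _ s hs => by
          rcases eq_or_ne x c with rfl | hxc
          · rw [Function.update_self]
            constructor <;> intro <;> omega
          · rw [Function.update_of_ne hxc]
      have h2 : rowWord X (Function.update u c r) r = rowWord X u r ++ [c] := by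
        refine rowWord_eq ?_ fun x => ?_
        · refine List.pairwise_append.2 ⟨pairwise_rowWord u r, List.pairwise_singleton _ _,
            fun x hx y hy => ?_⟩
          rw [List.mem_singleton.1 hy]
          have h3 := (mem_rowWord.1 hx).2
          by_contra h4
          rcases eq_or_ne x c with rfl | hxc
          · omega
          · exact hex x (by omega) h3
        · rw [List.mem_append, List.mem_singleton, mem_rowWord]
          rcases eq_or_ne x c with rfl | hxc
          · simp [hcX]
          · simp [hxc]
      rw [h1, h2, List.append_assoc]
      exact .refl _

end reading

lemma kn_readWord_run {X H : ℕ} (hH : X ≤ H) (w : List ℕ) (hn : w.Nodup)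
    (hw : ∀ c ∈ w, 1 ≤ c ∧ c ≤ X) : Kn w (readWord X (run w fun _ => 0) 1 H) := by
  induction w using List.reverseRecOn with
  | nil =>
    have : ∀ m r, 1 ≤ r → readWord X (fun _ => 0) r m = [] := by
      intro m
      induction m with
      | zero => exact fun _ _ => rfl
      | succ m ih =>
        intro r hr
        have h0 : 0 ≠ r := by omega
        rw [readWord, ih _ (by omega)]
        simp [rowWord, h0]
    rw [run, List.foldl_nil, this _ _ le_rfl]
    exact .refl _
  | append_singleton w c ih =>
    rw [List.nodup_append] at hn
    have hcw : c ∉ w := fun h => hn.2.2 c h c (by simp) rfl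
    have hc := hw c (by simp)
    have h1 := ih hn.1 fun d hd => hw d (by simp [hd])
    have h2 := Kn.readWord_bump (X := X) (c := c) (H := H) (u := run w fun _ => 0) (r := 1) le_rfl
      hc.1 hc.2 (by rw [run_eq_zero hcw rfl]; omega) (by omega) fun x hx =>
        run_eq_zero (fun h => by have := hw x (by simp [h]); omega) rfl
    rw [run_append]
    exact (h1.append_right [c]).trans h2

lemma kn_of_run_eq {v w : List ℕ} (hv : v.Nodup) (hw : w.Nodup) (hv1 : ∀ c ∈ v, 1 ≤ c)
    (hw1 : ∀ c ∈ w, 1 ≤ c) (h : run v (fun _ => 0) = run w fun _ => 0) : Kn v w := by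
  obtain ⟨X, hX⟩ : ∃ X, ∀ c ∈ v ++ w, c ≤ X :=
    ⟨(v ++ w).sum, fun c hc => List.le_sum_of_mem hc⟩
  have h1 := kn_readWord_run (X := X) le_rfl v hv fun c hc => ⟨hv1 c hc, hX c (by simp [hc])⟩
  have h2 := kn_readWord_run (X := X) le_rfl w hw fun c hc => ⟨hw1 c hc, hX c (by simp [hc])⟩
  rw [h] at h1
  exact h1.trans h2.symm

/-- The word `w` has a decreasing subsequence of length `m`. -/
def HasDec (w : List ℕ) (m : ℕ) : Prop :=
  ∃ s : List ℕ, s.Sublist w ∧ s.Pairwise (· > ·) ∧ s.length = m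

lemma HasDec.replace {v w : List ℕ} (a b : List ℕ) {m : ℕ}
    (h : ∀ s : List ℕ, s.Sublist v → s.Pairwise (· > ·) → ∃ s' : List ℕ, s'.Sublist w ∧
      s'.Pairwise (· > ·) ∧ s'.length = s.length ∧ (∀ p, (∀ q ∈ s, q < p) → ∀ q ∈ s', q < p) ∧
      ∀ p, (∀ q ∈ s, p < q) → ∀ q ∈ s', p < q)
    (hd : HasDec (a ++ v ++ b) m) : HasDec (a ++ w ++ b) m := by
  obtain ⟨t, ht1, ht2, rfl⟩ := hd
  obtain ⟨t', s3, rfl, ht', h3⟩ := List.sublist_append_iff.1 ht1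
  obtain ⟨s1, s2, rfl, h1, h2⟩ := List.sublist_append_iff.1 ht'
  rw [List.pairwise_append, List.pairwise_append] at ht2
  obtain ⟨⟨p1, p2, p12⟩, p3, p13⟩ := ht2
  obtain ⟨s', g1, g2, g3, g4, g5⟩ := h s2 h2 p2
  refine ⟨s1 ++ s' ++ s3, (h1.append g1).append h3, ?_, by simp [g3]⟩
  rw [List.pairwise_append, List.pairwise_append]
  refine ⟨⟨p1, g2, fun p hp q hq => g4 p (fun q hq => p12 p hp q hq) q hq⟩, p3,
    fun p hp q hq => ?_⟩
  rcases List.mem_append.1 hp with hp | hp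
  · exact p13 p (by simp [hp]) q hq
  · exact g5 q (fun r hr => p13 r (by simp [hr]) q hq) p hp

lemma Kn.hasDec_iff {v w : List ℕ} (h : Kn v w) (m : ℕ) : HasDec v m ↔ HasDec w m := by
  induction h with
  | refl => exact Iff.rfl
  | symm _ ih => exact ih.symm
  | trans _ _ ih1 ih2 => exact ih1.trans ih2
  | @k1 a b x y z h1 h2 =>
    constructor <;> refine HasDec.replace a b fun s hs hp => ?_
    · rw [← List.mem_sublists'] at hs
      refine ⟨s, ?_, hp, rfl, fun _ h => h, fun _ h => h⟩
      simp at hs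
      rcases hs with rfl | rfl | rfl | rfl | rfl | rfl | rfl | rfl <;> simp at hp ⊢ <;> omega
    · by_cases hzx : s = [z, x]
      · subst hzx
        refine ⟨[y, x], by simp, by simp [h1], rfl, fun p h => ?_, fun p h => ?_⟩ <;>
          simp at h ⊢ <;> omega
      · rw [← List.mem_sublists'] at hs
        refine ⟨s, ?_, hp, rfl, fun _ h => h, fun _ h => h⟩
        simp at hs
        rcases hs with rfl | rfl | rfl | rfl | rfl | rfl | rfl | rfl <;> simp at hp hzx ⊢ <;> omega
  | @k2 a b x y z h1 h2 =>
    constructor <;> refine HasDec.replace a b fun s hs hp => ?_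
    · rw [← List.mem_sublists'] at hs
      refine ⟨s, ?_, hp, rfl, fun _ h => h, fun _ h => h⟩
      simp at hs
      rcases hs with rfl | rfl | rfl | rfl | rfl | rfl | rfl | rfl <;> simp at hp ⊢ <;> omega
    · by_cases hzx : s = [z, x]
      · subst hzx
        refine ⟨[z, y], by simp, by simp [h2], rfl, fun p h => ?_, fun p h => ?_⟩ <;>
          simp at h ⊢ <;> omega
      · rw [← List.mem_sublists'] at hs
        refine ⟨s, ?_, hp, rfl, fun _ h => h, fun _ h => h⟩
        simp at hs
        rcases hs with rfl | rfl | rfl | rfl | rfl | rfl | rfl | rfl <;> simp at hp hzx ⊢ <;> omega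

lemma le_of_mem_readWord {X x : ℕ} {u : ℕ → ℕ} {r m : ℕ} (h : x ∈ readWord X u r m) :
    x ≤ X ∧ r ≤ u x := by
  induction m generalizing r with
  | zero => simp [readWord] at h
  | succ m ih =>
    rcases List.mem_append.1 h with h | h
    · have := ih h
      omega
    · have := mem_rowWord.1 h
      omega

lemma HasDec.readWord_le {X : ℕ} {u : ℕ → ℕ} {r H n m : ℕ} (hu : ∀ x ≤ X, u x < r + n)
    (h : HasDec (readWord X u r H) m) : m ≤ n := by
  obtain ⟨s, hs, hp, rfl⟩ := h
  induction H generalizing r n s with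
  | zero => simp [List.eq_nil_of_sublist_nil hs]
  | succ H ih =>
    cases n with
    | zero =>
      cases s with
      | nil => simp
      | cons x s =>
        have h1 := le_of_mem_readWord (hs.subset (List.mem_cons_self))
        have := hu x h1.1
        omega
    | succ n =>
      obtain ⟨s1, s2, rfl, h1, h2⟩ := List.sublist_append_iff.1 hs
      rw [List.pairwise_append] at hp
      have h3 := ih (r := r + 1) (n := n) (fun x hx => by have := hu x hx; omega) s1 h1 hp.1
      have h4 : s2.length ≤ 1 := by
        rcases s2 with _ | ⟨x, _ | ⟨y, s2⟩⟩
        · simp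
        · simp
        · have h5 := (pairwise_rowWord u r).sublist h2
          have h6 := hp.2.1
          rw [List.pairwise_cons] at h5 h6
          have := h5.1 y (by simp)
          have := h6.1 y (by simp)
          omega
      rw [List.length_append]
      omega

lemma HasDec.le_of_run_le {w : List ℕ} {m n : ℕ} (hw : w.Nodup) (hw1 : ∀ c ∈ w, 1 ≤ c)
    (hn : ∀ x, run w (fun _ => 0) x ≤ n) (h : HasDec w m) : m ≤ n := by
  have h1 := kn_readWord_run (X := w.sum) le_rfl w hw fun c hc =>
    ⟨hw1 c hc, List.le_sum_of_mem hc⟩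
  exact ((h1.hasDec_iff m).1 h).readWord_le fun x _ => by have := hn x; omega

lemma exists_bump_eq_carry {r t : ℕ} {m : ℕ → Prop} {u : ℕ → ℕ} (h : carry r m u t ≠ 0) :
    ∃ y ≤ t, bump r m u y = carry r m u t := by
  induction t with
  | zero => exact absurd rfl h
  | succ t ih =>
    by_cases hm : m (t + 1)
    · exact ⟨t + 1, le_rfl, by simp [bump, carry, hm]⟩
    · by_cases hu : u (t + 1) = carry r m u t ∧ carry r m u t ≠ 0
      · refine ⟨t + 1, le_rfl, ?_⟩
        rw [bump, carry, if_neg hm, if_neg hm, if_pos hu, if_pos hu, hu.1]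
      · rw [carry, if_neg hm, if_neg hu] at h ⊢
        obtain ⟨y, hy, he⟩ := ih h
        exact ⟨y, by omega, he⟩

lemma exists_lt_run {w : List ℕ} (hw : w.Nodup) {x : ℕ} (hx : 2 ≤ run w (fun _ => 0) x) :
    ∃ y < x, run w (fun _ => 0) y + 1 = run w (fun _ => 0) x := by
  induction w using List.reverseRecOn generalizing x with
  | nil => simp [run] at hx
  | append_singleton w c ih =>
    rw [List.nodup_append] at hw
    have hcw : run w (fun _ => 0) c = 0 :=
      run_eq_zero (fun h => hw.2.2 c h c (by simp) rfl) rfl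
    rw [run_append] at hx ⊢
    have ih := @ih hw.1
    set u := run w fun _ => 0
    change 2 ≤ bump 1 (· = c) u x at hx
    change ∃ y < x, bump 1 (· = c) u y + 1 = bump 1 (· = c) u x
    have key : ∀ y, y ≠ c → bump 1 (· = c) u y ≠ u y →
        (∃ z < y, bump 1 (· = c) u z = u y) ∧ bump 1 (· = c) u y = u y + 1 := by
      intro y hyc hy
      cases y with
      | zero => exact absurd rfl hy
      | succ y =>
        by_cases hu : u (y + 1) = carry 1 (· = c) u y ∧ carry 1 (· = c) u y ≠ 0
        · obtain ⟨z, hz, he⟩ := exists_bump_eq_carry hu.2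
          refine ⟨⟨z, by omega, by rw [he, hu.1]⟩, ?_⟩
          rw [bump, if_neg hyc, if_pos hu]
        · rw [bump, if_neg hyc, if_neg hu] at hy
          exact absurd rfl hy
    rcases eq_or_ne x c with rfl | hxc
    · cases x with
      | zero =>
        change 2 ≤ u 0 at hx
        omega
      | succ x => simp [bump] at hx
    · by_cases hx' : bump 1 (· = c) u x = u x
      · rw [hx'] at hx ⊢
        obtain ⟨y, hy, he⟩ := ih hx
        by_cases hy' : bump 1 (· = c) u y = u y
        · exact ⟨y, hy, by rw [hy', he]⟩
        · obtain ⟨⟨z, hz, he'⟩, -⟩ := key y (by rintro rfl; omega) hy'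
          exact ⟨z, by omega, by rw [he', he]⟩
      · obtain ⟨⟨z, hz, he'⟩, h2⟩ := key x hxc hx'
        exact ⟨z, hz, by rw [he', h2]⟩

lemma exists_dec_readWord {X H r n x : ℕ} {u : ℕ → ℕ}
    (hu : ∀ x, 2 ≤ u x → ∃ y < x, u y + 1 = u x) (hr : 1 ≤ r) (hx : x ≤ X) (hxn : u x = r + n)
    (hn : n < H) : ∃ s z, (s ++ [z]).Sublist (readWord X u r H) ∧
      (s ++ [z]).Pairwise (· > ·) ∧ s.length = n ∧ z ≤ X ∧ u z = r := by
  induction n generalizing r H with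
  | zero =>
    obtain ⟨H, rfl⟩ : ∃ d, H = d + 1 := ⟨H - 1, by omega⟩
    refine ⟨[], x, ?_, by simp, rfl, hx, hxn⟩
    rw [readWord]
    exact (List.singleton_sublist.2 (mem_rowWord.2 ⟨hx, hxn⟩)).trans
      (List.sublist_append_right _ _)
  | succ n ih =>
    obtain ⟨H, rfl⟩ : ∃ d, H = d + 1 := ⟨H - 1, by omega⟩
    obtain ⟨s, z, h1, h2, h3, h4, h5⟩ := ih (r := r + 1) (H := H) (by omega) (by omega) (by omega)
    obtain ⟨y, hy, he⟩ := hu z (by omega)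
    refine ⟨s ++ [z], y, ?_, ?_, by simp [h3], by omega, by omega⟩
    · rw [readWord]
      exact h1.append (List.singleton_sublist.2 (mem_rowWord.2 ⟨by omega, by omega⟩))
    · rw [List.pairwise_append]
      refine ⟨h2, by simp, fun a ha b hb => ?_⟩
      rw [List.mem_singleton.1 hb]
      rcases List.mem_append.1 ha with ha | ha
      · have := (List.pairwise_append.1 h2).2.2 a ha z (by simp)
        omega
      · rw [List.mem_singleton.1 ha]
        exact hy

lemma hasDec_run {w : List ℕ} (hw : w.Nodup) (hw1 : ∀ c ∈ w, 1 ≤ c) (x : ℕ)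
    (hx : 1 ≤ run w (fun _ => 0) x) : HasDec w (run w (fun _ => 0) x) := by
  have h1 := kn_readWord_run (X := w.sum + x) (H := w.sum + x + run w (fun _ => 0) x) (by omega) w
    hw fun c hc => ⟨hw1 c hc, by have := List.le_sum_of_mem hc; omega⟩
  obtain ⟨s, z, h2, h3, h4, -⟩ := exists_dec_readWord (X := w.sum + x)
    (H := w.sum + x + run w (fun _ => 0) x) (r := 1) (n := run w (fun _ => 0) x - 1) (x := x)
    (fun _ => exists_lt_run hw) le_rfl (by omega) (by omega) (by omega)
  exact (h1.hasDec_iff _).2 ⟨_, h2, h3, by simp [h4]; omega⟩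

/-- The word consisting of the columns of the markers in row `j`. -/
noncomputable def rowL (M : ℕ → ℕ → Prop) (j : ℕ) : List ℕ :=
  if h : ∃ x, M x j then [h.choose] else []

/-- The columns of the markers in the rows `s + 1, …, s + m`. -/
noncomputable def wd (M : ℕ → ℕ → Prop) (s : ℕ) : ℕ → List ℕ
  | 0 => []
  | m + 1 => wd M s m ++ rowL M (s + m + 1)

/-- The cells `(c i, d i)`, `i < k`, are markers forming a decreasing sequence. -/
def IsCh (M : ℕ → ℕ → Prop) (k : ℕ) (c d : ℕ → ℕ) : Prop :=
  (∀ i < k, M (c i) (d i)) ∧ ∀ i j, i < j → j < k → c i < c j ∧ d j < d i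

section words

variable {M M' : ℕ → ℕ → Prop}

lemma rowL_eq_nil {j : ℕ} (h : ∀ x, ¬ M x j) : rowL M j = [] :=
  dif_neg fun ⟨x, hx⟩ => h x hx

lemma IsPP.rowL_eq (h : IsPP M) {x j : ℕ} (hx : M x j) : rowL M j = [x] := by
  have h1 : ∃ x, M x j := ⟨x, hx⟩
  rw [rowL, dif_pos h1, h.row _ _ _ h1.choose_spec hx]

lemma IsPP.mem_rowL (h : IsPP M) {x j : ℕ} : x ∈ rowL M j ↔ M x j := by
  by_cases h1 : ∃ y, M y j
  · obtain ⟨y, hy⟩ := h1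
    rw [h.rowL_eq hy, List.mem_singleton]
    exact ⟨fun e => e ▸ hy, fun hx => h.row _ _ _ hx hy⟩
  · rw [rowL_eq_nil fun x hx => h1 ⟨x, hx⟩]
    simpa using fun hx => h1 ⟨x, hx⟩

lemma rowL_congr {j : ℕ} (h : ∀ x, M x j ↔ M' x j) : rowL M j = rowL M' j := by
  have : (fun x => M x j) = fun x => M' x j := funext fun x => propext (h x)
  have h1 : (∃ x, M x j) = ∃ x, M' x j := by rw [this]
  by_cases h2 : ∃ x, M' x j
  · rw [rowL, rowL, dif_pos (h1 ▸ h2), dif_pos h2]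
    congr 2
  · rw [rowL, rowL, dif_neg (h1 ▸ h2), dif_neg h2]

lemma wd_congr {s m : ℕ} (h : ∀ x j, s < j → j ≤ s + m → (M x j ↔ M' x j)) :
    wd M s m = wd M' s m := by
  induction m with
  | zero => rfl
  | succ m ih =>
    rw [wd, wd, ih fun x j h1 h2 => h x j h1 (by omega),
      rowL_congr fun x => h x (s + m + 1) (by omega) (by omega)]

lemma wd_add (s m n : ℕ) : wd M s (m + n) = wd M s m ++ wd M (s + m) n := by
  induction n with
  | zero => simp [wd]
  | succ n ih => rw [← add_assoc, wd, ih, wd, List.append_assoc, add_assoc s m n]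

lemma IsPP.mem_wd (h : IsPP M) {x s m : ℕ} : x ∈ wd M s m ↔ ∃ j, s < j ∧ j ≤ s + m ∧ M x j := by
  induction m with
  | zero =>
    simp only [wd, List.not_mem_nil, false_iff]
    rintro ⟨j, h1, h2, -⟩
    omega
  | succ m ih =>
    rw [wd, List.mem_append, ih, h.mem_rowL]
    constructor
    · rintro (⟨j, h1, h2, h3⟩ | h3)
      · exact ⟨j, h1, by omega, h3⟩
      · exact ⟨_, by omega, by omega, h3⟩
    · rintro ⟨j, h1, h2, h3⟩
      rcases eq_or_ne j (s + m + 1) with rfl | hj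
      · exact .inr h3
      · exact .inl ⟨j, h1, by omega, h3⟩

lemma IsPP.nodup_wd (h : IsPP M) (s m : ℕ) : (wd M s m).Nodup := by
  induction m with
  | zero => simp [wd]
  | succ m ih =>
    rw [wd]
    by_cases h1 : ∃ x, M x (s + m + 1)
    · obtain ⟨x, hx⟩ := h1
      rw [h.rowL_eq hx, List.nodup_append]
      refine ⟨ih, by simp, fun y hy z hz e => ?_⟩
      obtain ⟨j, h2, h3, h4⟩ := h.mem_wd.1 hy
      rw [e, List.mem_singleton.1 hz] at h4
      have := h.col _ _ _ h4 hx
      omega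
    · rw [rowL_eq_nil fun x hx => h1 ⟨x, hx⟩]
      simpa using ih

lemma IsPP.one_le_of_mem_wd (h : IsPP M) {x s m : ℕ} (hx : x ∈ wd M s m) : 1 ≤ x := by
  obtain ⟨j, -, -, h3⟩ := h.mem_wd.1 hx
  exact (h.pos _ _ h3).1

lemma bump_of_not {r : ℕ} {m : ℕ → Prop} (hm : ∀ x, ¬ m x) (u : ℕ → ℕ) : bump r m u = u := by
  have hc : ∀ x, carry r m u x = 0 := fun x => by
    induction x with
    | zero => rfl
    | succ x ih => rw [carry, if_neg (hm _), ih, if_neg (by omega)]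
  funext x
  cases x with
  | zero => rfl
  | succ x => rw [bump, if_neg (hm _), hc, if_neg (by omega)]

lemma IsPP.state_add (h : IsPP M) (s m : ℕ) : state M (s + m) = run (wd M s m) (state M s) := by
  induction m with
  | zero => rfl
  | succ m ih =>
    rw [wd, run_append, ← ih, ← add_assoc, state]
    by_cases h1 : ∃ x, M x (s + m + 1)
    · obtain ⟨x, hx⟩ := h1
      rw [h.rowL_eq hx]
      have : (fun y => M y (s + m + 1)) = (· = x) :=
        funext fun y => propext ⟨fun hy => h.row _ _ _ hy hx, fun e => e ▸ hx⟩
      rw [this]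
      rfl
    · rw [rowL_eq_nil fun x hx => h1 ⟨x, hx⟩, bump_of_not fun x hx => h1 ⟨x, hx⟩]
      rfl

lemma IsPP.state_eq_run (h : IsPP M) (j : ℕ) : state M j = run (wd M 0 j) fun _ => 0 := by
  have := h.state_add 0 j
  rwa [Nat.zero_add] at this

lemma IsPP.exists_chain (h : IsPP M) {s m : ℕ} {t : List ℕ} (ht : t.Sublist (wd M s m))
    (hp : t.Pairwise (· > ·)) : ∃ p q, IsCh M t.length p q ∧
      ∀ i < t.length, p i ∈ t ∧ s < q i ∧ q i ≤ s + m := by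
  induction m generalizing t with
  | zero =>
    obtain rfl := List.eq_nil_of_sublist_nil ht
    exact ⟨fun _ => 0, fun _ => 0, ⟨by simp, by simp⟩, by simp⟩
  | succ m ih =>
    obtain ⟨t1, t2, rfl, h1, h2⟩ := List.sublist_append_iff.1 ht
    rw [List.pairwise_append] at hp
    obtain ⟨p, q, h3, h4⟩ := ih h1 hp.1
    rcases t2 with _ | ⟨x, t2⟩
    · rw [List.append_nil]
      exact ⟨p, q, h3, fun i hi => ⟨(h4 i hi).1, (h4 i hi).2.1, by have := h4 i hi; omega⟩⟩
    · have hx : M x (s + m + 1) := h.mem_rowL.1 (h2.subset List.mem_cons_self)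
      rw [h.rowL_eq hx] at h2
      obtain rfl : t2 = [] := by
        have := h2.length_le
        simpa using this
      have hl : (t1 ++ [x]).length = t1.length + 1 := by simp
      refine ⟨fun i => if i = 0 then x else p (i - 1),
        fun i => if i = 0 then s + m + 1 else q (i - 1), ⟨fun i hi => ?_, fun i j hij hj => ?_⟩,
        fun i hi => ?_⟩
      · rcases i with _ | i
        · exact hx
        · exact h3.1 i (by omega)
      · obtain ⟨j, rfl⟩ : ∃ j', j = j' + 1 := ⟨j - 1, by omega⟩
        have h5 := h4 j (by omega)
        rcases i with _ | i
        · have h6 := hp.2.2 _ h5.1 x (by simp)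
          simp only [if_true, Nat.add_one_ne_zero, if_false, Nat.add_sub_cancel]
          omega
        · exact h3.2 i j (by omega) (by omega)
      · rcases i with _ | i
        · exact ⟨by simp, by grind, by grind⟩
        · have h5 := h4 i (by omega)
          exact ⟨List.mem_append_left _ h5.1, h5.2.1, by
            simp only [Nat.add_one_ne_zero, if_false, Nat.add_sub_cancel]; omega⟩

lemma IsCh.exists_sublist (h : IsPP M) {s m k : ℕ} {c d : ℕ → ℕ} (hc : IsCh M k c d)
    (hd : ∀ i < k, s < d i ∧ d i ≤ s + m) : ∃ t : List ℕ, t.Sublist (wd M s m) ∧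
      t.Pairwise (· > ·) ∧ t.length = k ∧ ∀ z ∈ t, ∃ i < k, z = c i := by
  induction m generalizing k c d with
  | zero =>
    rcases k with _ | k
    · exact ⟨[], by simp, by simp, rfl, by simp⟩
    · have := hd 0 (by omega)
      omega
  | succ m ih =>
    rcases k with _ | k
    · exact ⟨[], by simp, by simp, rfl, by simp⟩
    by_cases h0 : d 0 = s + m + 1
    · obtain ⟨t, h1, h2, h3, h4⟩ := @ih k (fun i => c (i + 1)) (fun i => d (i + 1))
        ⟨fun i hi => hc.1 _ (by omega), fun i j hij hj => hc.2 _ _ (by omega) (by omega)⟩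
        fun i hi => ⟨(hd _ (by omega)).1, by have := hc.2 0 (i + 1) (by omega) (by omega); omega⟩
      refine ⟨t ++ [c 0], ?_, ?_, by simp [h3], fun z hz => ?_⟩
      · rw [wd, h.rowL_eq (h0 ▸ hc.1 0 (by omega))]
        exact h1.append (.refl _)
      · rw [List.pairwise_append]
        refine ⟨h2, by simp, fun z hz y hy => ?_⟩
        obtain ⟨i, hi, rfl⟩ := h4 z hz
        rw [List.mem_singleton.1 hy]
        exact (hc.2 0 (i + 1) (by omega) (by omega)).1
      · rcases List.mem_append.1 hz with hz | hz
        · obtain ⟨i, hi, rfl⟩ := h4 z hz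
          exact ⟨i + 1, by omega, rfl⟩
        · exact ⟨0, by omega, List.mem_singleton.1 hz⟩
    · obtain ⟨t, h1, h2, h3, h4⟩ := ih hc fun i hi => ⟨(hd i hi).1, by
        have := (hd 0 (by omega)).2
        rcases i with _ | i
        · omega
        · have := hc.2 0 (i + 1) (by omega) (by omega)
          omega⟩
      exact ⟨t, h1.trans (List.sublist_append_left _ _), h2, h3, h4⟩

lemma IsPP.restrict (h : IsPP M) (R : ℕ → ℕ → Prop) : IsPP fun x j => M x j ∧ R x j :=
  ⟨fun _ _ hx => h.pos _ _ hx.1, fun x i j hi hj => h.col x i j hi.1 hj.1,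
    fun x y j hi hj => h.row x y j hi.1 hj.1⟩

lemma IsCh.le_ht (h : IsPP M) {k x j : ℕ} {c d : ℕ → ℕ} (hc : IsCh M k c d)
    (hx : ∀ i < k, c i ≤ x ∧ d i ≤ j) : k ≤ ht M x j := by
  have h' := h.restrict fun y _ => y ≤ x
  obtain ⟨t, h1, h2, h3, -⟩ := IsCh.exists_sublist h' (s := 0) (m := j) (c := c) (d := d)
    (k := k) ⟨fun i hi => ⟨hc.1 i hi, (hx i hi).1⟩, hc.2⟩ fun i hi =>
      ⟨(h.pos _ _ (hc.1 i hi)).2, by have := hx i hi; omega⟩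
  refine HasDec.le_of_run_le (h'.nodup_wd 0 j) (fun c hc => h'.one_le_of_mem_wd hc) (fun y => ?_)
    ⟨t, h1, h2, h3⟩
  rw [← h'.state_eq_run]
  change colLab _ y j ≤ _
  by_cases hy : y ≤ x
  · rw [(labels_congr (M' := M) y j fun x' j' _ hx' _ _ => and_iff_left (hx'.trans hy)).1]
    exact h.colLab_le_ht j hy
  · rw [colLab_eq_zero y j fun j' _ hm => hy hm.2]
    exact Nat.zero_le _

lemma IsPP.exists_chain_of_le_ht (h : IsPP M) {k x j : ℕ} (hk : k ≤ ht M x j) :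
    ∃ p q, IsCh M k p q ∧ ∀ i < k, p i ≤ x ∧ q i ≤ j := by
  rcases k with _ | k
  · exact ⟨fun _ => 0, fun _ => 0, ⟨by simp, by simp⟩, by simp⟩
  have h' := h.restrict fun y _ => y ≤ x
  obtain ⟨y, hy1, hy, he⟩ := h.exists_colLab_eq_ht (x := x) (j := j) (by omega)
  have h1 : run (wd (fun y j => M y j ∧ y ≤ x) 0 j) (fun _ => 0) y = ht M x j := by
    rw [← h'.state_eq_run, ← he]
    exact (labels_congr (M' := M) y j fun x' j' _ hx' _ _ => and_iff_left (hx'.trans hy)).1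
  obtain ⟨t, h2, h3, h4⟩ := hasDec_run (h'.nodup_wd 0 j) (fun c hc => h'.one_le_of_mem_wd hc) y
    (by omega)
  rw [h1] at h4
  obtain ⟨p, q, h5, h6⟩ := h'.exists_chain h2 h3
  refine ⟨p, q, ⟨fun i hi => (h5.1 i (by omega)).1, fun i i' hi hi' => h5.2 _ _ hi (by omega)⟩,
    fun i hi => ⟨(h5.1 i (by omega)).2, ?_⟩⟩
  have := h6 i (by omega)
  omega

end words

section slide

variable {M M₀ M₁ : ℕ → ℕ → Prop}

lemma ht_eq_zero {x e : ℕ} (h : ∀ x j, M x j → e < j) : ht M x e = 0 := by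
  have : ∀ j ≤ e, ht M x j = 0 := fun j hj => by
    induction j with
    | zero => rfl
    | succ j ih =>
      rw [ht_succ_right, ih (by omega), rowLab_eq_zero x (j + 1) fun x' _ hm => by
        have := h _ _ hm
        omega]
      rfl
  exact this e le_rfl

lemma IsPP.ht_mono_left (h : IsPP M) {x y : ℕ} (j : ℕ) (hxy : x ≤ y) : ht M x j ≤ ht M y j :=
  monotone_nat_of_le_succ (f := fun x => ht M x j)
    (fun x => by rw [h.ht_succ_left]; exact le_max_left _ _) hxy

/-- The situation in the induction step on the length of the pattern. The fillings `M₀` and `M₁`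
have the same labels in height `b + 1` up to column `A`, and the same markers to the right of
column `A + 1`. The marker of `M₁` in column `A + 1` lies in row `e`, below all the markers of `M₀`,
and row `b + 1` of `M₁` is empty. -/
structure Slide (M₀ M₁ : ℕ → ℕ → Prop) (k A e b a : ℕ) : Prop where
  pp₀ : IsPP M₀
  pp₁ : IsPP M₁
  lt : e < b + 1
  above : ∀ x j, M₀ x j → e < j
  agree : ∀ x j, A + 1 < x → (M₀ x j ↔ M₁ x j)
  mem : M₁ (A + 1) e
  top : ∀ x, ¬ M₁ x (b + 1)
  colEq : ∀ x ≤ A, colLab M₀ x (b + 1) = colLab M₁ x (b + 1)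
  rowEq : ∀ j ≤ b, rowLab M₀ (A + 1) j = rowLab M₁ A j
  htLt : ht M₀ (A + 1) b < k
  leHt : k ≤ ht M₀ (A + 1) (b + 1)
  htLe : ∀ x < a, ht M₀ x (b + 1) ≤ k

variable {k A e b a : ℕ}

lemma Slide.column (h : Slide M₀ M₁ k A e b a) {j : ℕ} (hj : e ≤ j) (hjb : j ≤ b) :
    colLab M₁ (A + 1) j = ht M₀ (A + 1) j + 1 := by
  induction j, hj using Nat.le_induction with
  | base =>
    rw [ht_eq_zero h.above]
    have := (h.pp₁.pos _ _ h.mem).2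
    obtain ⟨e, rfl⟩ : ∃ e', e = e' + 1 := ⟨e - 1, by omega⟩
    rw [colLab_succ, if_pos h.mem]
  | succ j hj ih =>
    have hm : ¬ M₁ (A + 1) (j + 1) := fun hm => by
      have := h.pp₁.col _ _ _ hm h.mem
      omega
    have h1 := h.pp₀.rowLab_succ_le_ht (A + 1) j
    rw [colLab_succ, if_neg hm, ht_succ_right, ih (by omega), ← h.rowEq (j + 1) hjb]
    split_ifs <;> omega

lemma Slide.rowLab_eq (h : Slide M₀ M₁ k A e b a) {j : ℕ} (hj : e ≤ j) (hjb : j < b) :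
    rowLab M₁ (A + 1) (j + 1) = if rowLab M₀ (A + 1) (j + 1) = ht M₀ (A + 1) j + 1 then
      rowLab M₀ (A + 1) (j + 1) + 1 else rowLab M₀ (A + 1) (j + 1) := by
  have hm : ¬ M₁ (A + 1) (j + 1) := fun hm => by
    have := h.pp₁.col _ _ _ hm h.mem
    omega
  rw [rowLab_succ, if_neg hm, h.column hj hjb.le, ← h.rowEq (j + 1) hjb]
  split_ifs <;> omega

lemma Slide.rowLab_top (h : Slide M₀ M₁ k A e b a) :
    rowLab M₀ (A + 1) (b + 1) = k ∧ ht M₀ (A + 1) b + 1 = k := by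
  have h1 := h.pp₀.rowLab_succ_le_ht (A + 1) b
  have h2 := h.leHt
  have h3 := h.htLt
  rw [ht_succ_right] at h2
  omega

lemma Slide.rowLab_top_eq_zero (h : Slide M₀ M₁ k A e b a) (x : ℕ) : rowLab M₁ x (b + 1) = 0 :=
  rowLab_eq_zero _ _ fun x _ => h.top x

lemma Slide.colLab_top (h : Slide M₀ M₁ k A e b a) :
    colLab M₀ (A + 1) (b + 1) = colLab M₁ (A + 1) (b + 1) := by
  have he := h.lt
  have h1 : colLab M₁ (A + 1) (b + 1) = k := by
    rw [colLab_succ, if_neg (h.top _), h.rowLab_top_eq_zero, if_neg (by omega),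
      h.column (by omega) le_rfl, h.rowLab_top.2]
  have hk : 1 ≤ k := by
    have := h.htLt
    omega
  have h2 := h.pp₀.shapeU_eq_shapeW (A + 1) (b + 1) k hk
  have h3 := h.pp₁.shapeU_eq_shapeW A (b + 1) k hk
  have h4 : shapeW M₀ (A + 1) b k = shapeW M₁ A b k :=
    Finset.sum_congr rfl fun j hj => by rw [h.rowEq _ (Finset.mem_range.1 hj)]
  have h5 : shapeU M₀ A (b + 1) k = shapeU M₁ A (b + 1) k :=
    Finset.sum_congr rfl fun x hx => by rw [h.colEq _ (Finset.mem_range.1 hx)]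
  rw [shapeU_succ, shapeW_succ, h.rowLab_top.1, if_pos rfl] at h2
  rw [shapeW_succ, h.rowLab_top_eq_zero, if_neg (by omega)] at h3
  rw [h1]
  by_contra hne
  rw [if_neg hne] at h2
  omega

lemma Slide.colLab_le_ht (h : Slide M₀ M₁ k A e b a) {x j : ℕ} (hx : A + 1 ≤ x) (hxa : x + 1 < a)
    (hj : j ≤ b + 1) : colLab M₀ (x + 1) j ≤ ht M₀ x j := by
  by_contra! hlt
  have key : ∀ i, j ≤ i → colLab M₀ (x + 1) i = ht M₀ x i + 1 := fun i hi => by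
    induction i, hi using Nat.le_induction with
    | base =>
      have := colLab_succ_le_ht (M := M₀) x j
      omega
    | succ i hi ih =>
      have hm : ¬ M₀ (x + 1) (i + 1) := fun hm => by
        have := h.pp₀.colLab_eq_zero hm
        omega
      have h1 := h.pp₀.rowLab_succ_le_ht x i
      rw [colLab_succ, if_neg hm, ht_succ_right, ih]
      split_ifs <;> omega
  have h1 := key _ hj
  have h2 := h.pp₀.colLab_le_ht (b + 1) (le_refl (x + 1))
  have h3 := h.htLe _ hxa
  have h4 := h.leHt
  have h5 := h.pp₀.ht_mono_left (b + 1) hx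
  omega

lemma Slide.ht_eq (h : Slide M₀ M₁ k A e b a) {x j : ℕ} (hx : A + 1 ≤ x) (hxa : x + 1 < a)
    (hj : j ≤ b + 1) : ht M₀ (x + 1) j = ht M₀ x j := by
  rw [h.pp₀.ht_succ_left, max_eq_left (h.colLab_le_ht hx hxa hj)]

/-- The relation between the labels of the edges in column `x` in the two fillings. -/
def SlideAt (M₀ M₁ : ℕ → ℕ → Prop) (k e b x : ℕ) : Prop :=
  (∀ j, e ≤ j → j < b → rowLab M₁ x (j + 1) = if rowLab M₀ x (j + 1) = ht M₀ x j + 1 then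
      rowLab M₀ x (j + 1) + 1 else rowLab M₀ x (j + 1)) ∧
    rowLab M₀ x (b + 1) = k ∧ ht M₀ x b + 1 = k

lemma Slide.colLab_eq (h : Slide M₀ M₁ k A e b a) {x : ℕ} (hx : A + 1 ≤ x) (hxa : x + 1 < a)
    (hs : SlideAt M₀ M₁ k e b x) {j : ℕ} (hj : e ≤ j) (hjb : j ≤ b) :
    colLab M₀ (x + 1) j = colLab M₁ (x + 1) j := by
  induction j, hj using Nat.le_induction with
  | base =>
    rw [GrowthDiagram.colLab_eq_zero _ _ fun i hi hm => by have := h.above _ _ hm; omega,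
      GrowthDiagram.colLab_eq_zero _ _ fun i hi hm => by
        have := h.above _ _ ((h.agree _ _ (by omega)).2 hm); omega]
  | succ j hj ih =>
    have h1 := hs.1 j hj hjb
    have h2 := ih (by omega)
    have h3 := h.colLab_le_ht hx hxa (j := j) (by omega)
    have h4 := h.agree (x + 1) (j + 1) (by omega)
    rw [colLab_succ, colLab_succ, h1, ← h2]
    by_cases hm : M₀ (x + 1) (j + 1)
    · rw [if_pos hm, if_pos (h4.1 hm)]
    · rw [if_neg hm, if_neg (mt h4.2 hm)]
      split_ifs <;> omega

lemma Slide.slideAt_succ (h : Slide M₀ M₁ k A e b a) {x : ℕ} (hx : A + 1 ≤ x) (hxa : x + 1 < a)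
    (hs : SlideAt M₀ M₁ k e b x) : SlideAt M₀ M₁ k e b (x + 1) := by
  refine ⟨fun j hj hjb => ?_, ?_, by rw [h.ht_eq hx hxa (by omega), hs.2.2]⟩
  · have h1 := hs.1 j hj hjb
    have h2 := h.colLab_eq hx hxa hs hj hjb.le
    have h3 := h.colLab_le_ht hx hxa (j := j) (by omega)
    have h4 := h.agree (x + 1) (j + 1) (by omega)
    have h5 := h.colLab_le_ht hx hxa (j := j + 1) (by omega)
    rw [h.ht_eq hx hxa (by omega), rowLab_succ, rowLab_succ, h1, ← h2]
    rw [colLab_succ, ht_succ_right] at h5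
    by_cases hm : M₀ (x + 1) (j + 1)
    · have h6 := h.pp₀.rowLab_eq_zero hm
      rw [if_pos hm] at h5 ⊢
      rw [if_pos (h4.1 hm), if_neg (by omega)]
    · rw [if_neg hm] at h5 ⊢
      rw [if_neg (mt h4.2 hm)]
      split_ifs at h5 ⊢ <;> omega
  · have h3 := h.colLab_le_ht hx hxa (j := b) (by omega)
    have h4 : ¬ M₀ (x + 1) (b + 1) := fun hm => h.top _ ((h.agree _ _ (by omega)).1 hm)
    rw [rowLab_succ, if_neg h4, if_neg (by have := hs.2; omega), hs.2.1]

lemma Slide.slideAt (h : Slide M₀ M₁ k A e b a) {x : ℕ} (hx : A + 1 ≤ x) (hxa : x < a) :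
    SlideAt M₀ M₁ k e b x := by
  induction x, hx using Nat.le_induction with
  | base => exact ⟨fun j hj hjb => h.rowLab_eq hj hjb, h.rowLab_top⟩
  | succ x hx ih => exact h.slideAt_succ hx hxa (ih (by omega))

lemma Slide.colLab_top_eq (h : Slide M₀ M₁ k A e b a) {x : ℕ} (hxa : x < a) :
    colLab M₀ x (b + 1) = colLab M₁ x (b + 1) := by
  rcases lt_trichotomy x (A + 1) with hx | rfl | hx
  · exact h.colEq x (by omega)
  · exact h.colLab_top
  · obtain ⟨x, rfl⟩ : ∃ x', x = x' + 1 := ⟨x - 1, by omega⟩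
    have hs := h.slideAt (x := x) (by omega) (by omega)
    have he := h.lt
    have h3 := h.colLab_le_ht (x := x) (by omega) hxa (j := b) (by omega)
    have h4 : ¬ M₀ (x + 1) (b + 1) := fun hm => h.top _ ((h.agree _ _ (by omega)).1 hm)
    rw [colLab_succ, colLab_succ, if_neg h4, if_neg (h.top _), h.rowLab_top_eq_zero,
      if_neg (by have := hs.2; omega), if_neg (by omega),
      h.colLab_eq (by omega) hxa hs (by omega) le_rfl]

end slide

lemma wd_above (e m : ℕ) {N : ℕ → ℕ → Prop} :
    wd (fun x j => N x j ∧ e < j) 0 (e + m) = wd N e m := by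
  rw [wd_add, Nat.zero_add, wd_congr (M' := N) fun x j h1 _ => and_iff_left h1,
    wd_congr (M' := fun _ _ => False) fun x j _ h2 => by simp; omega]
  have : ∀ n, wd (fun _ _ => False) 0 n = [] := fun n => by
    induction n with
    | zero => rfl
    | succ n ih => rw [wd, ih, rowL_eq_nil fun _ h => h]; rfl
  rw [this, List.nil_append]

/-- The labels at the top of two fillings which agree in the lower rows are the same if they are
the same after removing these rows. -/
lemma state_eq_of_state_above {N N' : ℕ → ℕ → Prop} (h : IsPP N) (h' : IsPP N') {e m : ℕ}
    (hN : ∀ x j, j ≤ e → (N x j ↔ N' x j))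
    (hs : state (fun x j => N x j ∧ e < j) (e + m) = state (fun x j => N' x j ∧ e < j) (e + m)) :
    state N (e + m) = state N' (e + m) := by
  rw [(h.restrict fun _ j => e < j).state_eq_run, (h'.restrict fun _ j => e < j).state_eq_run,
    wd_above, wd_above] at hs
  have hk := kn_of_run_eq (h.nodup_wd e m) (h'.nodup_wd e m) (fun c hc => h.one_le_of_mem_wd hc)
    (fun c hc => h'.one_le_of_mem_wd hc) hs
  have hl := hk.append_left (wd N 0 e)
  have hw := wd_add (M := N) 0 e m
  have hw' := wd_add (M := N') 0 e m
  rw [Nat.zero_add] at hw hw'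
  rw [← hw, wd_congr (M' := N') (s := 0) (m := e) fun x j _ h2 => hN x j (by omega), ← hw'] at hl
  rw [h.state_eq_run, h'.state_eq_run]
  exact hl.run_eq (h.nodup_wd _ _) fun c hc => ⟨h.one_le_of_mem_wd hc, rfl⟩

/-- The filling obtained from `M` by replacing the markers `(c i, d i)` by `(c i, d (i + 1))`,
with indices modulo `k`. -/
def shift (M : ℕ → ℕ → Prop) (k : ℕ) (c d : ℕ → ℕ) (x j : ℕ) : Prop :=
  (M x j ∧ ∀ i < k, ¬ (x = c i ∧ j = d i)) ∨ (∃ i, i + 1 < k ∧ x = c i ∧ j = d (i + 1)) ∨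
    (x = c (k - 1) ∧ j = d 0)

/-- The decreasing sequence `(c i, d i)` is to the south-west of every other decreasing sequence
of length `k` whose last column is at most `c (k - 1)` and whose first row is at most `d 0`. -/
def IsSW (M : ℕ → ℕ → Prop) (k : ℕ) (c d : ℕ → ℕ) : Prop :=
  ∀ p q, IsCh M k p q → p (k - 1) ≤ c (k - 1) → q 0 ≤ d 0 → ∀ i < k, c i ≤ p i ∧ d i ≤ q i

section shift

variable {M : ℕ → ℕ → Prop} {k : ℕ} {c d : ℕ → ℕ}

lemma IsCh.col_inj (h : IsCh M k c d) {i j : ℕ} (hi : i < k) (hj : j < k) (he : c i = c j) :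
    i = j := by
  rcases lt_trichotomy i j with hij | hij | hij
  · have := h.2 i j hij hj
    omega
  · exact hij
  · have := h.2 j i hij hi
    omega

lemma IsCh.transpose (h : IsCh M k c d) :
    IsCh (fun a b => M b a) k (fun i => d (k - 1 - i)) (fun i => c (k - 1 - i)) :=
  ⟨fun i hi => h.1 _ (by omega), fun i j hij hj => (h.2 _ _ (by omega) (by omega)).symm⟩

lemma IsSW.transpose (h : IsSW M k c d) :
    IsSW (fun a b => M b a) k (fun i => d (k - 1 - i)) (fun i => c (k - 1 - i)) := by
  intro p q hp h1 h2 i hi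
  have h3 := h _ _ hp.transpose (by simpa using h2) (by simpa using h1) (k - 1 - i) (by omega)
  rw [show k - 1 - (k - 1 - i) = i by omega] at h3
  exact h3.symm

lemma shift_transpose : (fun a b => shift M k c d b a) =
    shift (fun a b => M b a) k (fun i => d (k - 1 - i)) (fun i => c (k - 1 - i)) := by
  funext a b
  refine propext (or_congr (and_congr_right fun _ => ?_) (or_congr ?_ ?_))
  · refine ⟨fun h i hi he => h (k - 1 - i) (by omega) he.symm, fun h i hi he => h (k - 1 - i)
      (by omega) ?_⟩
    beta_reduce
    rw [show k - 1 - (k - 1 - i) = i by omega]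
    exact he.symm
  · constructor
    · rintro ⟨i, hi, rfl, rfl⟩
      refine ⟨k - 1 - (i + 1), by omega, ?_, ?_⟩
      · beta_reduce
        rw [show k - 1 - (k - 1 - (i + 1)) = i + 1 by omega]
      · beta_reduce
        rw [show k - 1 - (k - 1 - (i + 1) + 1) = i by omega]
    · rintro ⟨i, hi, rfl, rfl⟩
      refine ⟨k - 1 - (i + 1), by omega, rfl, ?_⟩
      rw [show k - 1 - (i + 1) + 1 = k - 1 - i by omega]
  · beta_reduce
    rw [Nat.sub_zero, Nat.sub_self]
    exact and_comm

lemma IsCh.shift_col (h : IsCh M k c d) (hM : IsPP M) {i j : ℕ} (hi : i < k)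
    (hs : shift M k c d (c i) j) : j = if i + 1 < k then d (i + 1) else d 0 := by
  rcases hs with ⟨h1, h2⟩ | ⟨l, hl, h1, h2⟩ | ⟨h1, h2⟩
  · exact absurd ⟨rfl, hM.col _ _ _ h1 (h.1 i hi)⟩ (h2 i hi)
  · obtain rfl := h.col_inj hi (by omega) h1
    rw [if_pos hl, h2]
  · obtain rfl := h.col_inj hi (by omega) h1
    rw [if_neg (by omega), h2]

lemma shift_iff_of_ne {x : ℕ} (hx : ∀ i < k, x ≠ c i) (hk : 1 ≤ k) (j : ℕ) :
    shift M k c d x j ↔ M x j := by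
  constructor
  · rintro (⟨h1, -⟩ | ⟨l, hl, h1, -⟩ | ⟨h1, -⟩)
    · exact h1
    · exact absurd h1 (hx l (by omega))
    · exact absurd h1 (hx _ (by omega))
  · exact fun h => .inl ⟨h, fun i hi he => hx i hi he.1⟩

lemma IsCh.shift_col_eq (h : IsCh M k c d) (hM : IsPP M) (hk : 1 ≤ k) (x i j : ℕ)
    (hi : shift M k c d x i) (hj : shift M k c d x j) : i = j := by
  by_cases hx : ∃ l < k, x = c l
  · obtain ⟨l, hl, rfl⟩ := hx
    rw [h.shift_col hM hl hi, h.shift_col hM hl hj]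
  · push Not at hx
    exact hM.col x i j ((shift_iff_of_ne hx hk i).1 hi) ((shift_iff_of_ne hx hk j).1 hj)

lemma IsCh.isPP_shift (h : IsCh M k c d) (hM : IsPP M) (hk : 1 ≤ k) : IsPP (shift M k c d) := by
  refine ⟨?_, h.shift_col_eq hM hk, fun x y j hx hy => ?_⟩
  · rintro x j (⟨h1, -⟩ | ⟨l, hl, rfl, rfl⟩ | ⟨rfl, rfl⟩)
    · exact hM.pos _ _ h1
    · exact ⟨(hM.pos _ _ (h.1 l (by omega))).1, (hM.pos _ _ (h.1 (l + 1) (by omega))).2⟩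
    · exact ⟨(hM.pos _ _ (h.1 (k - 1) (by omega))).1, (hM.pos _ _ (h.1 0 (by omega))).2⟩
  · have h1 := h.transpose.shift_col_eq hM.transpose hk j x y
    rw [← shift_transpose] at h1
    exact h1 hx hy

end shift

section main

variable {M : ℕ → ℕ → Prop} {k : ℕ} {c d : ℕ → ℕ}

lemma IsCh.col_lt (h : IsCh M (k + 1) c d) {i : ℕ} (hi : i < k) : c i < c k :=
  (h.2 i k hi (by omega)).1

lemma IsCh.lt_row (h : IsCh M (k + 1) c d) {i : ℕ} (hi : i < k) : d k < d i :=
  (h.2 i k hi (by omega)).2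

lemma IsCh.append (h : IsCh M k c d) {x j : ℕ} (hx : M x j) (hc : ∀ i < k, c i < x ∧ j < d i) :
    IsCh M (k + 1) (fun i => if i < k then c i else x) (fun i => if i < k then d i else j) := by
  refine ⟨fun i hi => ?_, fun i l hil hl => ?_⟩
  · by_cases hik : i < k
    · simpa only [if_pos hik] using h.1 i hik
    · simpa only [if_neg hik] using hx
  · have hik : i < k := by omega
    by_cases hlk : l < k
    · simpa only [if_pos hik, if_pos hlk] using h.2 i l hil hlk
    · simpa only [if_pos hik, if_neg hlk] using hc i hik

/-- The part of the filling `M` strictly to the left of column `a` and strictly above row `e`. -/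
abbrev innerPart (M : ℕ → ℕ → Prop) (a e : ℕ) (x j : ℕ) : Prop := M x j ∧ e < j ∧ x < a

lemma IsCh.inner (h : IsCh M (k + 1) c d) : IsCh (innerPart M (c k) (d k)) k c d :=
  ⟨fun i hi => ⟨h.1 i (by omega), h.lt_row hi, h.col_lt hi⟩,
    fun i j hij hj => h.2 i j hij (by omega)⟩

lemma IsSW.inner (hs : IsSW M (k + 1) c d) (h : IsCh M (k + 1) c d) (hk : 1 ≤ k) :
    IsSW (innerPart M (c k) (d k)) k c d := by
  intro p q hp h1 h2 i hi
  have hp' : IsCh M k p q := ⟨fun i hi => (hp.1 i hi).1, hp.2⟩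
  have h3 := hs _ _ (hp'.append (h.1 k (by omega)) fun i hi => ⟨(hp.1 i hi).2.2, (hp.1 i hi).2.1⟩)
    (by simp) (by simpa [show 0 < k from hk] using h2) i (by omega)
  simpa only [if_pos hi] using h3

lemma shift_inner_iff (h : IsCh M (k + 1) c d) (hM : IsPP M) (hk : 1 ≤ k) {x j : ℕ}
    (hx : x ≠ c (k - 1)) : shift (innerPart M (c k) (d k)) k c d x j ↔
      shift M (k + 1) c d x j ∧ d k ≤ j ∧ x < c k := by
  constructor
  · rintro (⟨⟨h1, h2, h3⟩, h4⟩ | ⟨i, hi, rfl, rfl⟩ | ⟨h1, -⟩)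
    · refine ⟨.inl ⟨h1, fun i hi he => ?_⟩, h2.le, h3⟩
      rcases eq_or_ne i k with rfl | hik
      · omega
      · exact h4 i (by omega) he
    · exact ⟨.inr (.inl ⟨i, by omega, rfl, rfl⟩), (h.lt_row hi).le, h.col_lt (by omega)⟩
    · exact absurd h1 hx
  · rintro ⟨⟨h1, h2⟩ | ⟨i, hi, rfl, rfl⟩ | ⟨rfl, -⟩, h3, h4⟩
    · refine .inl ⟨⟨h1, lt_of_le_of_ne h3 ?_, h4⟩, fun i hi => h2 i (by omega)⟩
      rintro rfl
      have := hM.row _ _ _ h1 (h.1 k (by omega))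
      omega
    · refine .inr (.inl ⟨i, ?_, rfl, rfl⟩)
      by_contra hi'
      exact hx (by rw [show i = k - 1 by omega])
    · exact absurd h4 (by simp)

lemma IsCh.inner_iff (h : IsCh M (k + 1) c d) (hM : IsPP M) (hk : 1 ≤ k) {x j : ℕ}
    (hx : c (k - 1) < x) : innerPart M (c k) (d k) x j ↔
      shift M (k + 1) c d x j ∧ d k ≤ j ∧ x < c k := by
  rw [← shift_inner_iff h hM hk hx.ne']
  refine (shift_iff_of_ne (fun i hi he => ?_) hk j).symm
  rcases eq_or_ne i (k - 1) with rfl | hi'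
  · omega
  · have := (h.2 i (k - 1) (by omega) (by omega)).1
    omega

lemma IsCh.col_le (h : IsCh M k c d) {i j : ℕ} (hij : i ≤ j) (hj : j < k) :
    c i ≤ c j ∧ d j ≤ d i := by
  rcases eq_or_lt_of_le hij with rfl | hij
  · exact ⟨le_rfl, le_rfl⟩
  · have := h.2 i j hij hj
    omega

lemma IsCh.slide (h : IsCh M (k + 1) c d) (hM : IsPP M) (hs : IsSW M (k + 1) c d) (hk : 1 ≤ k)
    (hT : ∀ x < c (k - 1), colLab (innerPart M (c k) (d k)) x (d 0) =
      colLab (shift (innerPart M (c k) (d k)) k c d) x (d 0))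
    (hR : ∀ j < d 0, rowLab (innerPart M (c k) (d k)) (c (k - 1)) j =
      rowLab (shift (innerPart M (c k) (d k)) k c d) (c (k - 1)) j) :
    Slide (innerPart M (c k) (d k)) (fun x j => shift M (k + 1) c d x j ∧ d k ≤ j ∧ x < c k) k
      (c (k - 1) - 1) (d k) (d 0 - 1) (c k) := by
  have hA := (hM.pos _ _ (h.1 (k - 1) (by omega))).1
  have hb := (hM.pos _ _ (h.1 0 (by omega))).2
  have hA' : c (k - 1) - 1 + 1 = c (k - 1) := by omega
  have hb' : d 0 - 1 + 1 = d 0 := by omega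
  have hpp : IsPP (innerPart M (c k) (d k)) := hM.restrict fun x j => d k < j ∧ x < c k
  refine ⟨hpp, (h.isPP_shift hM (by omega)).restrict _, ?_, fun x j hx => hx.2.1, fun x j hx => ?_,
    ?_, ?_, fun x hx => ?_, fun j hj => ?_, ?_, ?_, fun x hx => ?_⟩
  · rw [hb']
    exact h.lt_row hk
  · exact h.inner_iff hM hk (by omega)
  · rw [hA']
    exact ⟨.inr (.inl ⟨k - 1, by omega, rfl, by rw [show k - 1 + 1 = k by omega]⟩), le_rfl,
      h.col_lt (by omega)⟩
  · rw [hb']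
    rintro x ⟨⟨h1, h2⟩ | ⟨i, hi, rfl, h2⟩ | ⟨rfl, -⟩, h3, h4⟩
    · exact h2 0 (by omega) ⟨hM.row _ _ _ h1 (h.1 0 (by omega)), rfl⟩
    · have := h.2 0 (i + 1) (by omega) (by omega)
      omega
    · simp at h4
  · rw [hb', hT x (by omega)]
    exact (labels_congr _ _ fun x' j' _ hx' _ _ => shift_inner_iff h hM hk (by omega)).1
  · rw [hA', hR j (by omega)]
    trans rowLab (shift (innerPart M (c k) (d k)) k c d) (c (k - 1) - 1) j
    · rcases j with _ | j
      · simp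
      have hno : ∀ i ≤ j + 1, ¬ shift (innerPart M (c k) (d k)) k c d (c (k - 1)) i := fun i hi hm => by
        have := h.inner.shift_col hpp (i := k - 1) (by omega) hm
        rw [if_neg (by omega)] at this
        omega
      rw [← hA'] at hno ⊢
      rw [rowLab_succ, if_neg (hno _ le_rfl),
        GrowthDiagram.colLab_eq_zero _ _ fun i hi => hno i (by omega), if_neg (by omega)]
      simp
    · exact (labels_congr _ _ fun x' j' _ hx' _ _ => shift_inner_iff h hM hk (by omega)).2
  · rw [hA']
    by_contra! hlt
    obtain ⟨p, q, h1, h2⟩ := hpp.exists_chain_of_le_ht hlt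
    have h3 := hs.inner h hk p q h1 (h2 _ (by omega)).1
      (by have := (h2 0 (by omega)).2; omega) 0 (by omega)
    have := (h2 0 (by omega)).2
    omega
  · rw [hA', hb']
    exact h.inner.le_ht hpp fun i hi => ⟨(h.inner.col_le (by omega) (by omega)).1,
      (h.inner.col_le (Nat.zero_le _) hi).2⟩
  · rw [hb']
    by_contra! hlt
    obtain ⟨p, q, h1, h2⟩ := hpp.exists_chain_of_le_ht (k := k + 1) hlt
    have h4 := (h2 k (by omega)).1
    have h3 := hs p q ⟨fun i hi => (h1.1 i hi).1, h1.2⟩ (by simp; omega) (h2 0 (by omega)).2 k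
      (by omega)
    omega

lemma IsCh.colLab_eq_of_inner (h : IsCh M (k + 1) c d) (hM : IsPP M) (hk : 1 ≤ k)
    (heq : ∀ x < c k, colLab (innerPart M (c k) (d k)) x (d 0) =
      colLab (fun x j => shift M (k + 1) c d x j ∧ d k ≤ j ∧ x < c k) x (d 0)) {x : ℕ}
    (hx : x < c k) : colLab M x (d 0) = colLab (shift M (k + 1) c d) x (d 0) := by
  have he := (hM.pos _ _ (h.1 k (by omega))).2
  have hd := h.lt_row hk
  obtain ⟨m, hm⟩ : ∃ m, d 0 = d k - 1 + m := ⟨d 0 - (d k - 1), by omega⟩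
  have key := state_eq_of_state_above (N := fun x j => M x j ∧ x < c k)
    (N' := fun x j => shift M (k + 1) c d x j ∧ x < c k) (e := d k - 1) (m := m)
    (hM.restrict _) ((h.isPP_shift hM (by omega)).restrict _) (fun y j hj => ?_) ?_
  · rw [(labels_congr (M' := fun x j => M x j ∧ x < c k) x (d 0) fun y j _ hy _ _ =>
        (and_iff_left (hy.trans_lt hx)).symm).1,
      (labels_congr (M := shift M (k + 1) c d)
        (M' := fun x j => shift M (k + 1) c d x j ∧ x < c k) x (d 0) fun y j _ hy _ _ =>
        (and_iff_left (hy.trans_lt hx)).symm).1, hm]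
    exact congrFun key x
  · refine and_congr_left fun _ => ?_
    have hlt : ∀ i < k + 1, j < d i := fun i hi => by
      have := (h.col_le (i := i) (j := k) (by omega) (by omega)).2
      omega
    constructor
    · exact fun h1 => .inl ⟨h1, fun i hi h2 => by have := hlt i hi; omega⟩
    · rintro (⟨h1, -⟩ | ⟨i, hi, -, rfl⟩ | ⟨-, rfl⟩)
      · exact h1
      · exact absurd (hlt _ hi) (lt_irrefl _)
      · exact absurd (hlt 0 (by omega)) (lt_irrefl _)
  · rw [← hm]
    funext y
    by_cases hy : y < c k
    · refine Eq.trans ?_ ((heq y hy).trans ?_)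
      · refine (labels_congr y (d 0) fun z j _ hz _ _ => ⟨fun h1 => ⟨h1.1.1, ?_, h1.1.2⟩,
          fun h1 => ⟨⟨h1.1, h1.2.2⟩, by omega⟩⟩).1
        refine lt_of_le_of_ne (by have := h1.2; omega) ?_
        rintro rfl
        have := hM.row _ _ _ h1.1.1 (h.1 k (by omega))
        omega
      · exact (labels_congr y (d 0) fun z j _ hz _ _ => ⟨fun h1 => ⟨⟨h1.1, h1.2.2⟩, by omega⟩,
          fun h1 => ⟨h1.1.1, by omega, h1.1.2⟩⟩).1
    · exact (colLab_eq_zero y (d 0) fun _ _ h1 => hy h1.1.2).trans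
        (colLab_eq_zero y (d 0) fun _ _ h1 => hy h1.1.2).symm

/-- The labels on the upper border of the rectangle spanned by a south-west decreasing sequence
do not change when this sequence is shifted, except possibly in the last column. -/
lemma IsCh.colLab_shift (hk : 1 ≤ k) (h : IsCh M k c d) (hM : IsPP M) (hs : IsSW M k c d) {x : ℕ}
    (hx : x < c (k - 1)) : colLab M x (d 0) = colLab (shift M k c d) x (d 0) := by
  induction k, hk using Nat.le_induction generalizing M c d x with
  | base =>
    refine (labels_congr x (d 0) fun y j _ hy _ _ => (shift_iff_of_ne (fun i hi => ?_) le_rfl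
      j).symm).1
    obtain rfl : i = 0 := by omega
    exact (hy.trans_lt hx).ne
  | succ k hk ih =>
    have hpp : IsPP (innerPart M (c k) (d k)) :=
      hM.restrict fun x j => d k < j ∧ x < c k
    have hsl := h.slide hM hs hk (fun x hx => ih h.inner hpp (hs.inner h hk) hx) fun j hj => by
      have h1 := ih h.inner.transpose hpp.transpose (hs.inner h hk).transpose (x := j)
        (by simpa using hj)
      rw [← shift_transpose] at h1
      simpa only [(labels_transpose _ _).1, Nat.sub_zero] using h1
    refine h.colLab_eq_of_inner hM hk (fun x hx => ?_) hx
    have hb := (hM.pos _ _ (h.1 0 (by omega))).2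
    have h1 := hsl.colLab_top_eq hx
    rwa [show d 0 - 1 + 1 = d 0 by omega] at h1

lemma IsCh.rowLab_shift (hk : 1 ≤ k) (h : IsCh M k c d) (hM : IsPP M) (hs : IsSW M k c d) {j : ℕ}
    (hj : j < d 0) : rowLab M (c (k - 1)) j = rowLab (shift M k c d) (c (k - 1)) j := by
  have h1 := h.transpose.colLab_shift hk hM.transpose hs.transpose (x := j) (by simpa using hj)
  rw [← shift_transpose] at h1
  simpa only [(labels_transpose _ _).1, Nat.sub_zero] using h1

end main

section lexMin

variable {M : ℕ → ℕ → Prop} {k : ℕ} {c d p q : ℕ → ℕ}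

lemma IsCh.splice (h : IsCh M k c d) (hp : IsCh M k p q) {i : ℕ} (hi : i < k) (h1 : p i < c i)
    (h2 : d i < q i) : IsCh M (k + 1) (fun l => if l ≤ i then p l else c (l - 1))
      (fun l => if l ≤ i then q l else d (l - 1)) := by
  refine ⟨fun l hl => ?_, fun l n hln hn => ?_⟩
  · by_cases hli : l ≤ i
    · simpa only [if_pos hli] using hp.1 l (by omega)
    · simpa only [if_neg hli] using h.1 (l - 1) (by omega)
  · by_cases hni : n ≤ i
    · simpa only [if_pos hni, if_pos (hln.le.trans hni)] using hp.2 l n hln (by omega)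
    · by_cases hli : l ≤ i
      · simp only [if_pos hli, if_neg hni]
        have h3 := hp.col_le hli hi
        have h4 := h.col_le (i := i) (j := n - 1) (by omega) (by omega)
        omega
      · simpa only [if_neg hli, if_neg hni] using h.2 (l - 1) (n - 1) (by omega) (by omega)

lemma IsCh.hybrid (h : IsCh M k c d) (hp : IsCh M k p q) {i : ℕ} (h1 : ∀ j < i, c j ≤ p j)
    (h2 : q i < d i) : IsCh M k (fun l => if l < i then c l else p l)
      (fun l => if l < i then d l else q l) := by
  refine ⟨fun l hl => ?_, fun l n hln hn => ?_⟩
  · by_cases hli : l < i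
    · simpa only [if_pos hli] using h.1 l hl
    · simpa only [if_neg hli] using hp.1 l hl
  · by_cases hni : n < i
    · simpa only [if_pos hni, if_pos (hln.trans hni)] using h.2 l n hln hn
    · by_cases hli : l < i
      · simp only [if_pos hli, if_neg hni]
        have h3 := h1 l hli
        have h4 := hp.2 l n hln hn
        have h5 := hp.col_le (i := i) (j := n) (by omega) (by omega)
        have h6 := h.2 l i hli (by omega)
        omega
      · simpa only [if_neg hli, if_neg hni] using hp.2 l n hln hn

/-- A lexicographically smallest decreasing sequence is to the south-west of all others. -/
lemma IsCh.isSW_of_lexMin (h : IsCh M k c d) (hM : IsPP M) (hle : ∀ x j, M x j → j ≤ d 0)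
    (hmin : ∀ p q, IsCh M k p q →
      (∀ i < k, d i = q i) ∨ ∃ i < k, d i < q i ∧ ∀ j < i, d j = q j) : IsSW M k c d := by
  intro p q hp _ _
  have hlong : ∀ p q, 1 ≤ k → ¬ IsCh M (k + 1) p q := fun p q hk hpq => by
    have h1 := hle _ _ (hpq.1 0 (by omega))
    have h2 := (hpq.2 0 1 (by omega) (by omega)).2
    rcases hmin (fun i => p (i + 1)) (fun i => q (i + 1)) ⟨fun i hi => hpq.1 _ (by omega),
      fun i j hij hj => hpq.2 _ _ (by omega) (by omega)⟩ with h3 | ⟨i, hi, h3, h4⟩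
    · have := h3 0 (by omega)
      simp only [Nat.zero_add] at this
      omega
    · rcases i with _ | i
      · simp only [Nat.zero_add] at h3
        omega
      · have := h4 0 (by omega)
        simp only [Nat.zero_add] at this
        omega
  have hcol : ∀ i < k, d i ≤ q i → c i ≤ p i := fun i hi hd => by
    by_contra! hlt
    refine hlong _ _ (by omega) (h.splice hp hi hlt (lt_of_le_of_ne hd fun he => ?_))
    have h1 := hM.row _ _ _ (he ▸ h.1 i hi) (hp.1 i hi)
    omega
  have hrow : ∀ i < k, d i ≤ q i := fun i hi => by
    induction i using Nat.strong_induction_on with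
    | _ i ih =>
      by_contra! hlt
      rcases hmin _ _ (h.hybrid hp (fun j hj => hcol j (by omega) (ih j hj (by omega))) hlt) with
        h1 | ⟨l, hl, h1, h2⟩
      · have := h1 i hi
        rw [if_neg (lt_irrefl _)] at this
        omega
      · rcases lt_trichotomy l i with hli | rfl | hli
        · rw [if_pos hli] at h1
          omega
        · rw [if_neg (lt_irrefl _)] at h1
          omega
        · have := h2 i hli
          rw [if_neg (lt_irrefl _)] at this
          omega
  exact fun i hi => ⟨hcol i hi (hrow i hi), hrow i hi⟩

end lexMin

/-- The extension of a sequence indexed by `Fin k` by zero. -/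
def ext0 {k : ℕ} (f : Fin k → ℕ) (i : ℕ) : ℕ := if h : i < k then f ⟨i, h⟩ else 0

lemma ext0_of_lt {k : ℕ} (f : Fin k → ℕ) {i : ℕ} (h : i < k) : ext0 f i = f ⟨i, h⟩ := dif_pos h

lemma mem_rect {a b : ℕ} {x : Cell} :
    x ∈ Rect a b ↔ 1 ≤ x.1 ∧ x.1 ≤ a ∧ 1 ≤ x.2 ∧ x.2 ≤ b := by
  simp only [Rect, Finset.mem_product, Finset.mem_Icc]
  tauto

lemma isPP_mark {F P : Finset Cell} (hP : IsPlacement F P) (a b : ℕ) :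
    IsPP (mark (P ∩ Rect a b)) := by
  refine ⟨fun x j h => ?_, fun x i j hi hj => ?_, fun x y j hx hy => ?_⟩
  · have := mem_rect.1 (Finset.mem_inter.1 h).2
    exact ⟨this.1, this.2.2.1⟩
  · exact congrArg Prod.snd
      (hP.2.1 _ (Finset.mem_inter.1 hi).1 _ (Finset.mem_inter.1 hj).1 rfl)
  · exact congrArg Prod.fst
      (hP.2.2 _ (Finset.mem_inter.1 hx).1 _ (Finset.mem_inter.1 hy).1 rfl)

section occurrence

variable {k : ℕ} {F P : Finset Cell} {D : Fin k → Cell}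

lemma IsDecSeq.mem_rect (hD : IsDecSeq P k D) (hF : IsFerrers F) (hP : IsPlacement F P)
    (hk : 0 < k) (i : Fin k) :
    D i ∈ Rect (D ⟨k - 1, by omega⟩).1 (D ⟨0, hk⟩).2 := by
  have h1 := hF _ (hP.1 (hD.1 i))
  refine GrowthDiagram.mem_rect.2 ⟨h1.1, ?_, h1.2.1, ?_⟩
  · rcases eq_or_ne i ⟨k - 1, by omega⟩ with hi | hi
    · rw [hi]
    · exact (hD.2 i ⟨k - 1, by omega⟩ (by
        have := i.2
        simp only [ne_eq, Fin.ext_iff, Fin.lt_def] at hi ⊢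
        omega)).1.le
  · rcases eq_or_ne i ⟨0, hk⟩ with hi | hi
    · rw [hi]
    · exact (hD.2 ⟨0, hk⟩ i (by
        simp only [ne_eq, Fin.ext_iff, Fin.lt_def] at hi ⊢
        omega)).2.le

lemma IsDecSeq.isCh {a b : ℕ} (hD : IsDecSeq P k D) (hR : ∀ i, D i ∈ Rect a b) :
    IsCh (mark (P ∩ Rect a b)) k (ext0 fun i => (D i).1) (ext0 fun i => (D i).2) := by
  refine ⟨fun i hi => ?_, fun i j hij hj => ?_⟩
  · rw [ext0_of_lt _ hi, ext0_of_lt _ hi]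
    exact Finset.mem_inter.2 ⟨hD.1 _, hR _⟩
  · rw [ext0_of_lt _ hj, ext0_of_lt _ hj, ext0_of_lt _ (hij.trans hj),
      ext0_of_lt _ (hij.trans hj)]
    exact hD.2 _ _ hij

lemma IsMinOcc.isSW {a b : ℕ} (hD : IsMinOcc F P k D) (hF : IsFerrers F) (hP : IsPlacement F P)
    (hk : 0 < k) (ha : a = (D ⟨k - 1, by omega⟩).1) (hb : b = (D ⟨0, hk⟩).2) :
    IsSW (mark (P ∩ Rect a b)) k (ext0 fun i => (D i).1) (ext0 fun i => (D i).2) := by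
  have hR : ∀ i, D i ∈ Rect a b := fun i => by
    rw [ha, hb]
    exact IsDecSeq.mem_rect hD.1.1 hF hP hk i
  refine (IsDecSeq.isCh hD.1.1 hR).isSW_of_lexMin (isPP_mark hP a b) (fun x j hx => ?_) fun p q hp => ?_
  · rw [ext0_of_lt _ hk, ← hb]
    exact (mem_rect.1 (Finset.mem_inter.1 hx).2).2.2.2
  · obtain ⟨a', b', h1, h2⟩ := hD.1.2
    have h3 := mem_rect.1 (h2 ⟨k - 1, by omega⟩)
    have h4 := mem_rect.1 (h2 ⟨0, hk⟩)
    have hpm : ∀ i : Fin k, (p i, q i) ∈ P ∧ (p i, q i) ∈ Rect a b := fun i =>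
      Finset.mem_inter.1 (hp.1 i i.2)
    have hpR : ∀ i : Fin k, (p i, q i) ∈ Rect a' b' := fun i => by
      have h5 := mem_rect.1 (hpm i).2
      exact mem_rect.2 (by simp only at h5 ⊢; omega)
    rcases hD.2 (fun i => (p i, q i)) ⟨⟨fun i => (hpm i).1, fun i j hij => hp.2 i j hij j.2⟩,
      a', b', h1, hpR⟩ with h5 | ⟨i, h5, h6⟩
    · refine .inl fun i hi => ?_
      rw [ext0_of_lt _ hi]
      exact h5 ⟨i, hi⟩
    · refine .inr ⟨i, i.2, ?_, fun j hj => ?_⟩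
      · rw [ext0_of_lt _ i.2]
        exact h5
      · rw [ext0_of_lt _ (hj.trans i.2)]
        exact h6 ⟨j, hj.trans i.2⟩ hj

lemma mark_phiStep {a b : ℕ} (hk : 0 < k) (hR : ∀ i, D i ∈ Rect a b) :
    mark (phiStep k D P ∩ Rect a b) =
      shift (mark (P ∩ Rect a b)) k (ext0 fun i => (D i).1) (ext0 fun i => (D i).2) := by
  have hcyc : ∀ i : ℕ, (hi : i + 1 < k) → cyc k ⟨i, by omega⟩ = ⟨i + 1, hi⟩ := fun i hi =>
    Fin.ext (Nat.mod_eq_of_lt hi)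
  have hlast : cyc k ⟨k - 1, by omega⟩ = ⟨0, hk⟩ := Fin.ext (by
    change (k - 1 + 1) % k = 0
    rw [Nat.sub_add_cancel hk, Nat.mod_self])
  funext x j
  refine propext ?_
  simp only [mark, phiStep, shift, Finset.mem_inter, Finset.mem_union, Finset.mem_sdiff,
    Finset.mem_image, Finset.mem_univ, true_and]
  constructor
  · rintro ⟨⟨h1, h2⟩ | ⟨i, hi⟩, h3⟩
    · refine .inl ⟨⟨h1, h3⟩, fun i hi he => h2 ⟨⟨i, hi⟩, ?_⟩⟩
      rw [ext0_of_lt _ hi, ext0_of_lt _ hi] at he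
      exact Prod.ext he.1.symm he.2.symm
    · obtain ⟨rfl, rfl⟩ := Prod.ext_iff.1 hi
      by_cases hik : (i : ℕ) + 1 < k
      · refine .inr (.inl ⟨i, hik, ?_, ?_⟩)
        · rw [ext0_of_lt _ i.2]
        · rw [ext0_of_lt _ hik]
          exact congrArg (fun i => (D i).2) (hcyc i hik)
      · have hie : i = ⟨k - 1, by omega⟩ := Fin.ext (by
          change (i : ℕ) = k - 1
          omega)
        refine .inr (.inr ⟨?_, ?_⟩)
        · rw [ext0_of_lt _ (by omega), ← hie]
        · rw [ext0_of_lt _ hk, ← hlast, ← hie]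
  · rintro (⟨⟨h1, h2⟩, h3⟩ | ⟨i, hi, rfl, rfl⟩ | ⟨rfl, rfl⟩)
    · refine ⟨.inl ⟨h1, ?_⟩, h2⟩
      rintro ⟨i, hi⟩
      refine h3 i i.2 ?_
      rw [ext0_of_lt _ i.2, ext0_of_lt _ i.2, Fin.eta, hi]
      exact ⟨rfl, rfl⟩
    · rw [ext0_of_lt _ hi, ext0_of_lt _ (by omega : i < k)]
      have h1 := mem_rect.1 (hR ⟨i, by omega⟩)
      have h2 := mem_rect.1 (hR ⟨i + 1, hi⟩)
      exact ⟨.inr ⟨⟨i, by omega⟩, by rw [hcyc i hi]⟩, mem_rect.2 ⟨h1.1, h1.2.1, h2.2.2⟩⟩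
    · rw [ext0_of_lt _ hk, ext0_of_lt _ (by omega : k - 1 < k)]
      have h1 := mem_rect.1 (hR ⟨k - 1, by omega⟩)
      have h2 := mem_rect.1 (hR ⟨0, hk⟩)
      exact ⟨.inr ⟨⟨k - 1, by omega⟩, by rw [hlast]⟩, mem_rect.2 ⟨h1.1, h1.2.1, h2.2.2⟩⟩

end occurrence

end GrowthDiagram

open GrowthDiagram

/-- **Main Lemma.** Fix `k ≥ 2`, let `D` be the value-smallest occurrence of `k…1` in
the placement `P` on the Ferrers board `F`, and let `R = R(a,b)` with `a = col(D_k)`,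
`b = row(D₁)`. Then `seq(P_R, R) = seq(φ(P)_R, R)` except possibly at the northeast
corner of `R` (the NE corner of square `(a,b)`). -/
theorem main_lemma (k : ℕ) (hk : 2 ≤ k) (F P : Finset Cell)
    (hF : IsFerrers F) (hP : IsPlacement F P)
    (D : Fin k → Cell) (hD : IsMinOcc F P k D)
    (a b : ℕ) (ha : a = (D ⟨k - 1, by omega⟩).1) (hb : b = (D ⟨0, by omega⟩).2) :
    ∀ c : Cell, BorderCorner (Rect a b) c → c ≠ (a, b) →
      gda gdaRule (P ∩ Rect a b) c.1 c.2 =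
        gda gdaRule (phiStep k D P ∩ Rect a b) c.1 c.2 := by
  have hk0 : 0 < k := by omega
  have hR : ∀ i, D i ∈ Rect a b := fun i => by
    rw [ha, hb]
    exact IsDecSeq.mem_rect hD.1.1 hF hP hk0 i
  have hM := isPP_mark hP a b
  have hc := IsDecSeq.isCh hD.1.1 hR
  have hs := IsMinOcc.isSW hD hF hP hk0 ha hb
  have hM' := hc.isPP_shift hM (by omega)
  have hck : ext0 (fun i => (D i).1) (k - 1) = a := by rw [ext0_of_lt _ (by omega), ha]
  have hd0 : ext0 (fun i => (D i).2) 0 = b := by rw [ext0_of_lt _ hk0, hb]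
  have hphi := mark_phiStep (P := P) hk0 hR
  rintro ⟨i, j⟩ ⟨h1, h2⟩ hne
  rw [mem_rect] at h1 h2
  rw [gda_eq_shapeU _ hM, gda_eq_shapeU _ (hphi ▸ hM'), hphi]
  funext n
  by_cases hj : j = b
  · have hia : i < a := lt_of_le_of_ne h1.2.1 fun he => hne (by rw [he, hj])
    refine Finset.sum_congr rfl fun y hy => ?_
    have hy' := Finset.mem_range.1 hy
    dsimp only at hy' ⊢
    have h3 := hc.colLab_shift (by omega) hM hs (x := y + 1) (by omega)
    rw [hd0] at h3
    rw [hj, h3]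
  · obtain rfl : i = a := by
      dsimp only at h1 h2
      omega
    rw [hM.shapeU_eq_shapeW _ _ _ (by omega), hM'.shapeU_eq_shapeW _ _ _ (by omega)]
    refine Finset.sum_congr rfl fun y hy => ?_
    have hy' := Finset.mem_range.1 hy
    dsimp only at h1 hy' ⊢
    have h3 := hc.rowLab_shift (by omega) hM hs (j := y + 1) (by omega)
    rw [hck] at h3
    rw [h3]
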